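/- arXiv:2510.26227 — 3 statements merged into one kernel-verified Lean document; each statement's English description precedes it below -/
import Mathlib

section
/- For every x > 0, the quantity J₀(x)·J₁(x) + Y₀(x)·Y₁(x) is strictly positive, where J₀, J₁ are Bessel functions of the first kind of orders 0 and 1, and Y₀, Y₁ are Bessel functions of the second kind of orders 0 and 1. -/
open Real MeasureTheory Filter

/-- Bessel function of the first kind of order `n`,
via the integral representation `Jₙ(x) = (1/π) ∫₀^π cos(nθ − x sin θ) dθ`. -/
noncomputable def besselJ (n : ℕ) (x : ℝ) : ℝ :=
  (1 / π) * ∫ θ in (0:ℝ)..π, Real.cos (n * θ - x * Real.sin θ)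

/-- Bessel function of the second kind of order `n`, via the standard
integral representation for `x > 0`. -/
noncomputable def besselY (n : ℕ) (x : ℝ) : ℝ :=
  (1 / π) * ∫ θ in (0:ℝ)..π, Real.sin (x * Real.sin θ - n * θ)
    - (1 / π) * ∫ t in Set.Ioi (0:ℝ),
        (Real.exp (n * t) + (-1 : ℝ) ^ n * Real.exp (-(n : ℝ) * t)) *
          Real.exp (-x * Real.sinh t)

/-- Modified Bessel function of the second kind of order `n`:
`Kₙ(y) = ∫₀^∞ e^{−y cosh u} cosh(n u) du`. -/
noncomputable def besselK (n : ℕ) (y : ℝ) : ℝ :=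
  ∫ u in Set.Ioi (0:ℝ), Real.exp (-y * Real.cosh u) * Real.cosh (n * u)


/-- The branch of `1 / sqrt (1 + z^2)` used for the contour integral. -/
noncomputable def bphi (z : ℂ) : ℂ := (1 + z ^ 2) ^ (((-1/2 : ℝ)) : ℂ)

lemma bphi_re_pos {s y : ℝ} (h : 0 < 1 + s ^ 2 - y ^ 2) :
    0 < (1 + ((s : ℂ) + y * Complex.I) ^ 2).re := by
  simp [pow_two]
  nlinarith

lemma bphi_differentiableAt {z : ℂ} (h : 0 < 1 + z.re ^ 2 - z.im ^ 2) :
    DifferentiableAt ℂ bphi z := by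
  unfold bphi
  apply DifferentiableAt.cpow_const
  · fun_prop
  · rw [Complex.mem_slitPlane_iff]
    left
    have := bphi_re_pos h
    rwa [Complex.re_add_im] at this

lemma bphi_ofReal_sq {z : ℂ} {c : ℝ} (hc : 0 < c) (h : 1 + z ^ 2 = ((c ^ 2 : ℝ) : ℂ)) :
    c * bphi z = 1 := by
  unfold bphi
  rw [h, ← Complex.ofReal_cpow (by positivity)]
  have : (c ^ 2) ^ (-1/2 : ℝ) = c⁻¹ := by
    rw [← Real.rpow_natCast, ← Real.rpow_mul hc.le]
    norm_num
    exact Real.rpow_neg_one c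
  rw [this]
  push_cast
  have : (c : ℂ) ≠ 0 := by exact_mod_cast hc.ne'
  field_simp

lemma bphi_norm_le {s y : ℝ} (hs : 0 < s) (hy : 0 ≤ y) :
    ‖bphi (-(s : ℂ) + y * Complex.I)‖ ≤ s ^ (-1/2 : ℝ) := by
  unfold bphi
  rw [Complex.norm_cpow_real]
  apply Real.rpow_le_rpow_of_nonpos hs _ (by norm_num)
  have e : (1 + (-(s : ℂ) + y * Complex.I) ^ 2) =
      (-(s : ℂ) + y * Complex.I - Complex.I) * (-(s : ℂ) + y * Complex.I + Complex.I) := by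
    ring_nf
    simp
    ring
  rw [e, norm_mul]
  have h1 : s ≤ ‖-(s : ℂ) + y * Complex.I - Complex.I‖ := by
    have := Complex.abs_re_le_norm (-(s : ℂ) + y * Complex.I - Complex.I)
    simp at this
    rwa [abs_of_pos hs] at this
  have h2 : 1 ≤ ‖-(s : ℂ) + y * Complex.I + Complex.I‖ := by
    have := Complex.abs_im_le_norm (-(s : ℂ) + y * Complex.I + Complex.I)
    simp at this
    rw [abs_of_pos (by linarith)] at this
    linarith
  nlinarith

lemma bphi_cone {s : ℝ} (hs : 0 < s) :
    0 < (bphi (-(s : ℂ) + (1 : ℝ) * Complex.I)).re ∧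
      0 ≤ (bphi (-(s : ℂ) + (1 : ℝ) * Complex.I)).im := by
  set w : ℂ := 1 + (-(s : ℂ) + (1 : ℝ) * Complex.I) ^ 2 with hw
  have hre : 0 < w.re := by
    simp [hw, pow_two]
    positivity
  have him : w.im < 0 := by
    simp [hw, pow_two]
    linarith
  have hw0 : w ≠ 0 := by
    intro h; rw [h] at hre; simp at hre
  have h1 : w.arg < 0 := Complex.arg_neg_iff.2 him
  have h2 := abs_lt.1 (Complex.abs_arg_lt_pi_div_two_iff.2 (Or.inl hre))
  have hpi := Real.pi_pos
  have e : bphi (-(s : ℂ) + (1 : ℝ) * Complex.I) =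
      Complex.exp (Complex.log w * ((-1/2 : ℝ) : ℂ)) := by
    unfold bphi
    rw [← hw, Complex.cpow_def_of_ne_zero hw0]
  rw [e, Complex.exp_re, Complex.exp_im, Complex.im_mul_ofReal, Complex.log_im]
  constructor
  · apply mul_pos (Real.exp_pos _)
    apply Real.cos_pos_of_mem_Ioo
    constructor <;> linarith
  · apply mul_nonneg (Real.exp_pos _).le
    apply Real.sin_nonneg_of_nonneg_of_le_pi <;> linarith

lemma contour_finite (g : ℂ → ℂ) (hg : Differentiable ℂ g) {a T : ℝ} (ha : 0 < a)
    (ha' : a < π / 2) (hT : 0 < T) :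
    (∫ t in (0:ℝ)..T, g (-(Real.sinh t : ℂ)))
      - (∫ s in (0:ℝ)..Real.sinh T,
          g (-(s : ℂ) + Real.sin a * Complex.I) * bphi (-(s : ℂ) + Real.sin a * Complex.I))
      + Complex.I * (∫ θ in (0:ℝ)..a, g (Real.sin θ * Complex.I))
      - Complex.I * (∫ y in (0:ℝ)..Real.sin a,
          g (-(Real.sinh T : ℂ) + y * Complex.I) * bphi (-(Real.sinh T : ℂ) + y * Complex.I))
      = 0 := by
  have hsa0 : 0 < Real.sin a := Real.sin_pos_of_pos_of_lt_pi ha (by linarith)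
  have hsa1 : Real.sin a < 1 := by
    have := Real.sin_lt_sin_of_lt_of_le_pi_div_two (x := a) (y := π / 2) (by linarith) le_rfl ha'
    simpa using this
  have hS : 0 < Real.sinh T := Real.sinh_pos_iff.2 hT
  set f : ℂ → ℂ := fun z => g z * bphi z with hf
  have hfd : ∀ z : ℂ, 0 < 1 + z.re ^ 2 - z.im ^ 2 → DifferentiableAt ℂ f z := fun z hz =>
    (hg z).mul (bphi_differentiableAt hz)
  have key := Complex.integral_boundary_rect_eq_zero_of_differentiableOn f
    (-(Real.sinh T : ℂ)) (Real.sin a * Complex.I) (by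
      intro z hz
      apply (hfd z _).differentiableWithinAt
      rw [Complex.mem_reProdIm] at hz
      have h2 := hz.2
      simp only [Complex.neg_im, Complex.ofReal_im, neg_zero, Complex.mul_im, Complex.ofReal_re,
        Complex.I_im, mul_one, Complex.I_re, mul_zero, add_zero] at h2
      rw [Set.uIcc_of_le hsa0.le] at h2
      nlinarith [h2.1, h2.2, sq_nonneg z.re])
  simp only [Complex.neg_im, Complex.neg_re, Complex.mul_re, Complex.ofReal_im, neg_zero,
    Complex.mul_im, Complex.ofReal_re, Complex.I_im, mul_one, Complex.I_re, mul_zero, add_zero,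
    sub_zero, zero_mul, Complex.ofReal_zero, smul_eq_mul, zero_add, Complex.ofReal_neg] at key
  have e1 : (∫ t in (0:ℝ)..T, g (-(Real.sinh t : ℂ))) = ∫ x in (-Real.sinh T)..0, f x := by
    have h := intervalIntegral.integral_deriv_smul_comp' (a := 0) (b := T) (f := Real.sinh)
      (f' := Real.cosh) (g := fun s : ℝ => f (-(s : ℂ)))
      (fun t _ => Real.hasDerivAt_sinh t) Real.continuous_cosh.continuousOn (by
        intro s _
        apply ContinuousAt.continuousWithinAt
        have : ContinuousAt f (-(s : ℂ)) := (hfd _ (by simp; positivity)).continuousAt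
        exact ContinuousAt.comp (f := fun s : ℝ => -(s : ℂ)) this (by fun_prop))
    have h' := intervalIntegral.integral_comp_neg (a := 0) (b := Real.sinh T)
      (fun s : ℝ => f (s : ℂ))
    simp only [Complex.ofReal_neg, neg_zero] at h'
    rw [← h']
    rw [Real.sinh_zero] at h
    rw [← h]
    apply intervalIntegral.integral_congr
    intro t _
    simp only [Function.comp, hf, Complex.real_smul]
    have := bphi_ofReal_sq (z := -(Real.sinh t : ℂ)) (Real.cosh_pos t) (by
      rw [Real.cosh_sq]; push_cast; ring)
    linear_combination (-g (-(Real.sinh t : ℂ))) * this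
  have e2 : (∫ s in (0:ℝ)..Real.sinh T,
          g (-(s : ℂ) + Real.sin a * Complex.I) * bphi (-(s : ℂ) + Real.sin a * Complex.I)) =
      ∫ x in (-Real.sinh T)..0, f (x + Real.sin a * Complex.I) := by
    have h' := intervalIntegral.integral_comp_neg (a := 0) (b := Real.sinh T)
      (fun s : ℝ => f (s + Real.sin a * Complex.I))
    simp only [Complex.ofReal_neg, neg_zero] at h'
    rw [← h']
  have e3 : (∫ θ in (0:ℝ)..a, g (Real.sin θ * Complex.I)) =
      ∫ y in (0:ℝ)..Real.sin a, f (y * Complex.I) := by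
    have hlt : ∀ t ∈ Set.uIcc 0 a, 0 < Real.cos t := by
      intro t ht
      rw [Set.uIcc_of_le ha.le] at ht
      exact Real.cos_pos_of_mem_Ioo ⟨by linarith [ht.1], by linarith [ht.2]⟩
    have h := intervalIntegral.integral_deriv_smul_comp' (a := 0) (b := a) (f := Real.sin)
      (f' := Real.cos) (g := fun s : ℝ => f ((s : ℂ) * Complex.I))
      (fun t _ => Real.hasDerivAt_sin t) Real.continuous_cos.continuousOn (by
        rintro _ ⟨t, ht, rfl⟩
        apply ContinuousAt.continuousWithinAt
        have : ContinuousAt f ((Real.sin t : ℂ) * Complex.I) := (hfd _ (by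
          have := hlt t ht
          have h3 := Real.sin_sq_add_cos_sq t
          rw [Complex.mul_I_re, Complex.mul_I_im, Complex.ofReal_im, Complex.ofReal_re]
          nlinarith)).continuousAt
        exact ContinuousAt.comp (f := fun s : ℝ => (s : ℂ) * Complex.I) this (by fun_prop))
    rw [Real.sin_zero] at h
    rw [← h]
    apply intervalIntegral.integral_congr
    intro t ht
    simp only [Function.comp, hf, Complex.real_smul]
    have := bphi_ofReal_sq (z := (Real.sin t : ℂ) * Complex.I) (hlt t ht) (by
      rw [Real.cos_sq']; push_cast; rw [mul_pow, Complex.I_sq]; ring)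
    linear_combination (-g ((Real.sin t : ℂ) * Complex.I)) * this
  rw [e1, e2, e3]
  exact key

lemma dom_integrable {c : ℝ} (hc : 0 < c) (C : ℝ) :
    IntegrableOn (fun s : ℝ => C * Real.exp (-c * s) * s ^ (-1/2 : ℝ)) (Set.Ioi 0) := by
  have := (integrableOn_rpow_mul_exp_neg_mul_rpow (p := 1) (s := -1/2) (b := c)
    (by norm_num) (by norm_num) hc).const_mul C
  refine this.congr (Eventually.of_forall fun s => ?_)
  simp only [Real.rpow_one]
  ring

/-- Integrability along horizontal lines. -/
lemma horiz_integrable (g : ℂ → ℂ) (hg : Differentiable ℂ g) {c C : ℝ} (hc : 0 < c)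
    (hb : ∀ s y : ℝ, 0 ≤ s → 0 ≤ y → y ≤ 1 →
      ‖g (-(s : ℂ) + y * Complex.I)‖ ≤ C * Real.exp (-c * s)) {y : ℝ} (hy0 : 0 ≤ y) (hy1 : y ≤ 1) :
    IntegrableOn (fun s : ℝ => g (-(s : ℂ) + y * Complex.I) * bphi (-(s : ℂ) + y * Complex.I))
      (Set.Ioi 0) := by
  refine Integrable.mono' (dom_integrable hc C) ?_ ?_
  · apply ContinuousOn.aestronglyMeasurable _ measurableSet_Ioi
    intro s hs
    have hs : 0 < s := hs
    apply ContinuousAt.continuousWithinAt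
    have : ContinuousAt (fun z => g z * bphi z) (-(s : ℂ) + y * Complex.I) :=
      ((hg _).mul (bphi_differentiableAt (by simp; nlinarith))).continuousAt
    exact ContinuousAt.comp (f := fun s : ℝ => -(s : ℂ) + y * Complex.I) this (by fun_prop)
  · filter_upwards [ae_restrict_mem measurableSet_Ioi] with s hs
    have hs : 0 < s := hs
    rw [norm_mul]
    exact mul_le_mul (hb s y hs.le hy0 hy1) (bphi_norm_le hs hy0) (norm_nonneg _)
      ((norm_nonneg _).trans (hb s y hs.le hy0 hy1))

lemma sinh_tendsto : Tendsto Real.sinh atTop atTop := by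
  apply tendsto_atTop_mono' _ _ tendsto_id
  filter_upwards [eventually_ge_atTop 0] with t ht
  exact Real.self_le_sinh_iff.2 ht

lemma sinh_integrable (g : ℂ → ℂ) (hg : Differentiable ℂ g) {c C : ℝ} (hc : 0 < c)
    (hb : ∀ s y : ℝ, 0 ≤ s → 0 ≤ y → y ≤ 1 →
      ‖g (-(s : ℂ) + y * Complex.I)‖ ≤ C * Real.exp (-c * s)) :
    IntegrableOn (fun t : ℝ => g (-(Real.sinh t : ℂ))) (Set.Ioi 0) := by
  have hC : 0 ≤ C := by
    have := (norm_nonneg _).trans (hb 0 0 le_rfl le_rfl zero_le_one)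
    simpa using this
  refine Integrable.mono' ((exp_neg_integrableOn_Ioi 0 hc).const_mul C) ?_ ?_
  · apply Continuous.aestronglyMeasurable
    have := hg.continuous
    have := Real.continuous_sinh
    fun_prop
  · filter_upwards [ae_restrict_mem measurableSet_Ioi] with t ht
    have ht : 0 < t := ht
    have h1 : t ≤ Real.sinh t := Real.self_le_sinh_iff.2 ht.le
    have := hb (Real.sinh t) 0 (by linarith) le_rfl zero_le_one
    simp only [Complex.ofReal_zero, zero_mul, add_zero] at this
    refine this.trans ?_
    apply mul_le_mul_of_nonneg_left (Real.exp_le_exp.2 _) hC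
    nlinarith

lemma contour_strip (g : ℂ → ℂ) (hg : Differentiable ℂ g) {c C : ℝ} (hc : 0 < c)
    (hb : ∀ s y : ℝ, 0 ≤ s → 0 ≤ y → y ≤ 1 →
      ‖g (-(s : ℂ) + y * Complex.I)‖ ≤ C * Real.exp (-c * s)) {a : ℝ} (ha : 0 < a)
    (ha' : a < π / 2) :
    (∫ t in Set.Ioi (0:ℝ), g (-(Real.sinh t : ℂ)))
      - (∫ s in Set.Ioi (0:ℝ),
          g (-(s : ℂ) + Real.sin a * Complex.I) * bphi (-(s : ℂ) + Real.sin a * Complex.I))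
      + Complex.I * (∫ θ in (0:ℝ)..a, g (Real.sin θ * Complex.I)) = 0 := by
  have hsa0 : 0 < Real.sin a := Real.sin_pos_of_pos_of_lt_pi ha (by linarith)
  have hsa1 : Real.sin a ≤ 1 := Real.sin_le_one a
  have t1 := intervalIntegral_tendsto_integral_Ioi 0 (sinh_integrable g hg hc hb) tendsto_id
  have t2 := intervalIntegral_tendsto_integral_Ioi 0
    (horiz_integrable g hg hc hb hsa0.le hsa1) sinh_tendsto
  have t3 : Tendsto (fun T : ℝ => ∫ y in (0:ℝ)..Real.sin a,
      g (-(Real.sinh T : ℂ) + y * Complex.I) * bphi (-(Real.sinh T : ℂ) + y * Complex.I))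
      atTop (nhds 0) := by
    have hC : 0 ≤ C := by
      have := (norm_nonneg _).trans (hb 0 0 le_rfl le_rfl zero_le_one)
      simpa using this
    have hlim : Tendsto (fun T : ℝ => C * Real.exp (-c * Real.sinh T)) atTop (nhds 0) := by
      have : Tendsto (fun T : ℝ => Real.exp (-(c * Real.sinh T))) atTop (nhds 0) :=
        Real.tendsto_exp_neg_atTop_nhds_zero.comp (sinh_tendsto.const_mul_atTop hc)
      have := this.const_mul C
      simpa using this
    apply squeeze_zero_norm' _ hlim
    filter_upwards [eventually_ge_atTop 1] with T hT
    have h1 : 1 ≤ Real.sinh T := hT.trans (Real.self_le_sinh_iff.2 (by linarith))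
    have := intervalIntegral.norm_integral_le_of_norm_le_const (a := 0) (b := Real.sin a)
      (C := C * Real.exp (-c * Real.sinh T))
      (f := fun y : ℝ => g (-(Real.sinh T : ℂ) + y * Complex.I) *
        bphi (-(Real.sinh T : ℂ) + y * Complex.I)) (by
        intro y hy
        rw [Set.uIoc_of_le hsa0.le] at hy
        rw [norm_mul]
        have h2 := hb (Real.sinh T) y (by linarith) hy.1.le (hy.2.trans hsa1)
        have h3 := bphi_norm_le (s := Real.sinh T) (y := y) (by linarith) hy.1.le
        have h4 : Real.sinh T ^ (-1/2 : ℝ) ≤ 1 :=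
          Real.rpow_le_one_of_one_le_of_nonpos h1 (by norm_num)
        calc _ ≤ (C * Real.exp (-c * Real.sinh T)) * 1 :=
              mul_le_mul h2 (h3.trans h4) (norm_nonneg _) (by positivity)
          _ = _ := mul_one _)
    refine this.trans ?_
    rw [sub_zero, abs_of_pos hsa0]
    exact mul_le_of_le_one_right (by positivity) hsa1
  have hl := ((t1.sub t2).add_const
    (Complex.I * (∫ θ in (0:ℝ)..a, g (Real.sin θ * Complex.I)))).sub (t3.const_mul Complex.I)
  have h0 := tendsto_nhds_unique hl (tendsto_const_nhds.congr' (f₁ := fun _ => (0:ℂ)) (by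
    filter_upwards [eventually_gt_atTop 0] with T hT
    exact (contour_finite g hg ha ha' hT).symm))
  rw [← h0]
  simp

lemma contour (g : ℂ → ℂ) (hg : Differentiable ℂ g) {c C : ℝ} (hc : 0 < c)
    (hb : ∀ s y : ℝ, 0 ≤ s → 0 ≤ y → y ≤ 1 →
      ‖g (-(s : ℂ) + y * Complex.I)‖ ≤ C * Real.exp (-c * s)) :
    (∫ t in Set.Ioi (0:ℝ), g (-(Real.sinh t : ℂ)))
      + Complex.I * (∫ θ in (0:ℝ)..(π/2), g (Real.sin θ * Complex.I)) =
    ∫ s in Set.Ioi (0:ℝ),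
          g (-(s : ℂ) + (1:ℝ) * Complex.I) * bphi (-(s : ℂ) + (1:ℝ) * Complex.I) := by
  have hpi := Real.pi_pos
  have hev : ∀ᶠ a in nhdsWithin (π/2) (Set.Iio (π/2)), 0 < a ∧ a < π / 2 := by
    filter_upwards [Ioo_mem_nhdsLT (show 0 < π / 2 by linarith)] with a ha using ha
  have hid : Tendsto (fun a : ℝ => a) (nhdsWithin (π/2) (Set.Iio (π/2))) (nhds (π/2)) :=
    tendsto_nhdsWithin_of_tendsto_nhds tendsto_id
  have t3 : Tendsto (fun a : ℝ => ∫ θ in (0:ℝ)..a, g (Real.sin θ * Complex.I))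
      (nhdsWithin (π/2) (Set.Iio (π/2)))
      (nhds (∫ θ in (0:ℝ)..(π/2), g (Real.sin θ * Complex.I))) := by
    have hcont : Continuous (fun θ : ℝ => g (Real.sin θ * Complex.I)) := by
      have := hg.continuous
      have := Real.continuous_sin
      fun_prop
    exact ((intervalIntegral.continuous_primitive
      (fun a b => hcont.intervalIntegrable a b) 0).tendsto _).comp hid
  have t2 : Tendsto (fun a : ℝ => ∫ s in Set.Ioi (0:ℝ),
          g (-(s : ℂ) + Real.sin a * Complex.I) * bphi (-(s : ℂ) + Real.sin a * Complex.I))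
      (nhdsWithin (π/2) (Set.Iio (π/2)))
      (nhds (∫ s in Set.Ioi (0:ℝ),
          g (-(s : ℂ) + (1:ℝ) * Complex.I) * bphi (-(s : ℂ) + (1:ℝ) * Complex.I))) := by
    apply tendsto_integral_filter_of_dominated_convergence
      (fun s : ℝ => C * Real.exp (-c * s) * s ^ (-1/2 : ℝ))
    · filter_upwards [hev] with a ha
      exact (horiz_integrable g hg hc hb
        (Real.sin_nonneg_of_nonneg_of_le_pi ha.1.le (by linarith)) (Real.sin_le_one a)).1
    · filter_upwards [hev] with a ha
      have hs0 := Real.sin_nonneg_of_nonneg_of_le_pi ha.1.le (by linarith)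
      filter_upwards [ae_restrict_mem measurableSet_Ioi] with s hs
      have hs : 0 < s := hs
      rw [norm_mul]
      exact mul_le_mul (hb s _ hs.le hs0 (Real.sin_le_one a)) (bphi_norm_le hs hs0)
        (norm_nonneg _) ((norm_nonneg _).trans (hb s _ hs.le hs0 (Real.sin_le_one a)))
    · exact dom_integrable hc C
    · filter_upwards [ae_restrict_mem measurableSet_Ioi] with s hs
      have hs : 0 < s := hs
      have hcz : ContinuousAt (fun z => g z * bphi z) (-(s : ℂ) + (1:ℝ) * Complex.I) :=
        ((hg _).mul (bphi_differentiableAt (by simp; positivity))).continuousAt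
      have hz : Tendsto (fun a : ℝ => -(s : ℂ) + Real.sin a * Complex.I)
          (nhdsWithin (π/2) (Set.Iio (π/2))) (nhds (-(s : ℂ) + (1:ℝ) * Complex.I)) := by
        have : Continuous (fun a : ℝ => -(s : ℂ) + Real.sin a * Complex.I) := by
          have := Real.continuous_sin
          fun_prop
        have h := (this.tendsto (π/2)).comp hid
        rw [Real.sin_pi_div_two] at h
        exact h
      exact hcz.tendsto.comp hz
  have hl := (t2.const_sub (∫ t in Set.Ioi (0:ℝ), g (-(Real.sinh t : ℂ)))).add
    (t3.const_mul Complex.I)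
  have h0 := tendsto_nhds_unique hl (tendsto_const_nhds.congr' (f₁ := fun _ => (0:ℂ)) (by
    filter_upwards [hev] with a ha
    exact (contour_strip g hg hc hb ha.1 ha.2).symm))
  linear_combination h0

lemma exp_bound {x : ℝ} (hx : 0 < x) (s y : ℝ) (hs : 0 ≤ s) :
    ‖Complex.exp (x * (-(s : ℂ) + y * Complex.I))‖ ≤ 1 * Real.exp (-(x / 2) * s) := by
  rw [Complex.norm_exp, one_mul]
  apply Real.exp_le_exp.2
  simp
  nlinarith

lemma mul_exp_bound {x : ℝ} (hx : 0 < x) (s y : ℝ) (hs : 0 ≤ s) (hy : 0 ≤ y) (hy1 : y ≤ 1) :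
    ‖(-(s : ℂ) + y * Complex.I) * Complex.exp (x * (-(s : ℂ) + y * Complex.I))‖ ≤
      (1 + 2 / x) * Real.exp (-(x / 2) * s) := by
  rw [norm_mul, Complex.norm_exp]
  have e : (x * (-(s : ℂ) + y * Complex.I)).re = -(x / 2) * s + -(x / 2) * s := by
    simp; ring
  rw [e, Real.exp_add, ← mul_assoc]
  apply mul_le_mul_of_nonneg_right _ (Real.exp_pos _).le
  have h1 : ‖-(s : ℂ) + y * Complex.I‖ ≤ s + 1 := by
    refine (norm_add_le _ _).trans ?_
    rw [norm_neg, norm_mul, Complex.norm_I, mul_one, Complex.norm_real, Complex.norm_real,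
      Real.norm_of_nonneg hs, Real.norm_of_nonneg hy]
    linarith
  have h2 : s + 1 ≤ (1 + 2 / x) * Real.exp (x / 2 * s) := by
    have h3 := Real.add_one_le_exp (x / 2 * s)
    have h4 : (1 + 2 / x) * (x / 2 * s + 1) = s + 1 + (x / 2 * s + 2 / x) := by
      field_simp
      ring
    have h5 : (1 + 2 / x) * (x / 2 * s + 1) ≤ (1 + 2 / x) * Real.exp (x / 2 * s) :=
      mul_le_mul_of_nonneg_left h3 (by positivity)
    have h6 : 0 ≤ x / 2 * s + 2 / x := by positivity
    linarith
  calc _ ≤ ((1 + 2 / x) * Real.exp (x / 2 * s)) * Real.exp (-(x / 2) * s) :=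
        mul_le_mul_of_nonneg_right (h1.trans h2) (Real.exp_pos _).le
    _ = _ := by
      rw [mul_assoc, ← Real.exp_add]
      have : x / 2 * s + -(x / 2) * s = 0 := by ring
      rw [this]; simp

lemma fold_pi (h : ℝ → ℝ) (hh : Continuous h) :
    ∫ θ in (0:ℝ)..π, h θ = ∫ θ in (0:ℝ)..(π/2), (h θ + h (π - θ)) := by
  have h2 := intervalIntegral.integral_comp_sub_left (a := 0) (b := π/2) h π
  rw [intervalIntegral.integral_add (hh.intervalIntegrable _ _)
    (Continuous.intervalIntegrable (by fun_prop) _ _), h2]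
  have e : π - π / 2 = π / 2 := by ring
  rw [e, sub_zero, intervalIntegral.integral_add_adjacent_intervals
    (hh.intervalIntegrable _ _) (hh.intervalIntegrable _ _)]

/-- A set integral over `Ioi 0` of a function with values in the open-closed first quadrant. -/
lemma cone_integral {F : ℝ → ℂ} (hF : IntegrableOn F (Set.Ioi 0))
    (h : ∀ s : ℝ, 0 < s → 0 < (F s).re ∧ 0 ≤ (F s).im) :
    0 < (∫ s in Set.Ioi (0:ℝ), F s).re ∧ 0 ≤ (∫ s in Set.Ioi (0:ℝ), F s).im := by
  constructor
  · have := integral_re hF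
    simp only [RCLike.re_to_complex] at this
    rw [← this]
    have hFr : IntegrableOn (fun s => (F s).re) (Set.Ioi 0) := hF.re
    rw [setIntegral_pos_iff_support_of_nonneg_ae _ hFr]
    · have hsub : Set.Ioi (0:ℝ) ⊆ (Function.support fun s => (F s).re) ∩ Set.Ioi 0 := by
        intro s hs
        exact ⟨(h s hs).1.ne', hs⟩
      refine lt_of_lt_of_le ?_ (measure_mono hsub)
      simp
    · filter_upwards [ae_restrict_mem measurableSet_Ioi] with s hs
      exact (h s hs).1.le
  · have := integral_im hF
    simp only [RCLike.im_to_complex] at this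
    rw [← this]
    exact setIntegral_nonneg measurableSet_Ioi fun s hs => (h s hs).2

lemma integral_complex_parts (u v : ℝ → ℝ) (hu : Continuous u) (hv : Continuous v) (a b : ℝ) :
    ∫ θ in a..b, ((u θ : ℂ) + (v θ : ℂ) * Complex.I) =
      ((∫ θ in a..b, u θ : ℝ) : ℂ) + ((∫ θ in a..b, v θ : ℝ) : ℂ) * Complex.I := by
  rw [intervalIntegral.integral_add, intervalIntegral.integral_mul_const,
    intervalIntegral.integral_ofReal, intervalIntegral.integral_ofReal]
  · exact Continuous.intervalIntegrable (by fun_prop) _ _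
  · exact Continuous.intervalIntegrable (by fun_prop) _ _

lemma exp_sin (x θ : ℝ) : Complex.exp (x * (Real.sin θ * Complex.I)) =
    (Real.cos (x * Real.sin θ) : ℂ) + (Real.sin (x * Real.sin θ) : ℂ) * Complex.I := by
  rw [Complex.ofReal_cos (x * _), Complex.ofReal_sin (x * _), ← Complex.exp_mul_I]
  push_cast
  ring_nf

lemma main_pos (x : ℝ) (hx : 0 < x) :
    0 < (∫ θ in (0:ℝ)..(π/2), Real.cos (x * Real.sin θ)) *
          (∫ θ in (0:ℝ)..(π/2), Real.sin θ * Real.sin (x * Real.sin θ)) +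
        ((∫ t in Set.Ioi (0:ℝ), Real.exp (-x * Real.sinh t)) -
          ∫ θ in (0:ℝ)..(π/2), Real.sin (x * Real.sin θ)) *
        ((∫ θ in (0:ℝ)..(π/2), Real.sin θ * Real.cos (x * Real.sin θ)) +
          ∫ t in Set.Ioi (0:ℝ), Real.sinh t * Real.exp (-x * Real.sinh t)) := by
  have hcs := Real.continuous_sin
  have hcc := Real.continuous_cos
  have hx2 : 0 < x / 2 := by linarith
  have hg0 : Differentiable ℂ (fun z : ℂ => Complex.exp (x * z)) := by fun_prop
  have hg1 : Differentiable ℂ (fun z : ℂ => z * Complex.exp (x * z)) := by fun_prop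
  have hb0 : ∀ s y : ℝ, 0 ≤ s → 0 ≤ y → y ≤ 1 →
      ‖(fun z : ℂ => Complex.exp (x * z)) (-(s : ℂ) + y * Complex.I)‖ ≤
        1 * Real.exp (-(x / 2) * s) := fun s y hs _ _ => exp_bound hx s y hs
  have hb1 : ∀ s y : ℝ, 0 ≤ s → 0 ≤ y → y ≤ 1 →
      ‖(fun z : ℂ => z * Complex.exp (x * z)) (-(s : ℂ) + y * Complex.I)‖ ≤
        (1 + 2 / x) * Real.exp (-(x / 2) * s) := fun s y hs h1 h2 => mul_exp_bound hx s y hs h1 h2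
  have c0 := contour _ hg0 hx2 hb0
  have c1 := contour _ hg1 hx2 hb1
  have i0 := horiz_integrable _ hg0 hx2 hb0 zero_le_one le_rfl
  have i1 := horiz_integrable _ hg1 hx2 hb1 zero_le_one le_rfl
  set E : ℂ := Complex.exp (x * Complex.I) with hE
  set FA : ℝ → ℂ := fun s => (Real.exp (-x * s) : ℂ) * bphi (-(s : ℂ) + (1:ℝ) * Complex.I) with hFA
  set FB : ℝ → ℂ := fun s => (s : ℂ) * FA s with hFB
  have hE0 : E ≠ 0 := Complex.exp_ne_zero _
  have ee : ∀ s : ℝ, Complex.exp (x * (-(s : ℂ) + (1:ℝ) * Complex.I)) =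
      E * (Real.exp (-x * s) : ℂ) := by
    intro s
    rw [hE, Complex.ofReal_exp, ← Complex.exp_add]
    congr 1
    push_cast
    ring
  have r0 : ∀ s : ℝ, Complex.exp (x * (-(s : ℂ) + (1:ℝ) * Complex.I)) *
      bphi (-(s : ℂ) + (1:ℝ) * Complex.I) = E * FA s := by
    intro s
    rw [ee, hFA]; ring
  have r1 : ∀ s : ℝ, (-(s : ℂ) + (1:ℝ) * Complex.I) *
      Complex.exp (x * (-(s : ℂ) + (1:ℝ) * Complex.I)) *
      bphi (-(s : ℂ) + (1:ℝ) * Complex.I) = E * (Complex.I * FA s - FB s) := by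
    intro s
    rw [ee, hFB, hFA]; push_cast; ring
  simp only [r0] at c0 i0
  simp only [r1] at c1 i1
  have iA : IntegrableOn FA (Set.Ioi 0) := by
    have := i0.const_mul E⁻¹
    refine this.congr (Eventually.of_forall fun s => ?_)
    simp [hE0]
  have iB : IntegrableOn FB (Set.Ioi 0) := by
    have h := i1.const_mul E⁻¹
    have h' := (iA.const_mul Complex.I).sub h
    refine h'.congr (Eventually.of_forall fun s => ?_)
    simp [hE0]
  rw [integral_const_mul] at c0
  rw [integral_const_mul, integral_sub (iA.const_mul _) iB, integral_const_mul] at c1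
  have pA := cone_integral iA (fun s hs => by
    rw [hFA]
    simp only [Complex.re_ofReal_mul, Complex.im_ofReal_mul]
    have := bphi_cone hs
    exact ⟨mul_pos (Real.exp_pos _) this.1, mul_nonneg (Real.exp_pos _).le this.2⟩)
  have pB := cone_integral iB (fun s hs => by
    rw [hFB, hFA]
    simp only [Complex.re_ofReal_mul, Complex.im_ofReal_mul]
    have := bphi_cone hs
    exact ⟨mul_pos hs (mul_pos (Real.exp_pos _) this.1),
      mul_nonneg hs.le (mul_nonneg (Real.exp_pos _).le this.2)⟩)
  set A := ∫ s in Set.Ioi (0:ℝ), FA s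
  set B := ∫ s in Set.Ioi (0:ℝ), FB s
  -- left-hand sides
  have l0 : ∫ t in Set.Ioi (0:ℝ), Complex.exp (x * -(Real.sinh t : ℂ)) =
      ((∫ t in Set.Ioi (0:ℝ), Real.exp (-x * Real.sinh t) : ℝ) : ℂ) := by
    rw [← integral_complex_ofReal]
    congr 1; funext t; push_cast; ring_nf
  have l1 : ∫ t in Set.Ioi (0:ℝ), -(Real.sinh t : ℂ) * Complex.exp (x * -(Real.sinh t : ℂ)) =
      -((∫ t in Set.Ioi (0:ℝ), Real.sinh t * Real.exp (-x * Real.sinh t) : ℝ) : ℂ) := by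
    rw [← integral_complex_ofReal, ← integral_neg]
    congr 1; funext t; push_cast; ring_nf
  have m0 : ∫ θ in (0:ℝ)..(π/2), Complex.exp (x * (Real.sin θ * Complex.I)) =
      ((∫ θ in (0:ℝ)..(π/2), Real.cos (x * Real.sin θ) : ℝ) : ℂ) +
      ((∫ θ in (0:ℝ)..(π/2), Real.sin (x * Real.sin θ) : ℝ) : ℂ) * Complex.I := by
    rw [← integral_complex_parts _ _ (by fun_prop) (by fun_prop)]
    simp only [exp_sin]
  have m1 : ∫ θ in (0:ℝ)..(π/2), (Real.sin θ * Complex.I) *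
        Complex.exp (x * (Real.sin θ * Complex.I)) =
      (((∫ θ in (0:ℝ)..(π/2), Real.sin θ * Real.cos (x * Real.sin θ) : ℝ) : ℂ) +
      ((∫ θ in (0:ℝ)..(π/2), Real.sin θ * Real.sin (x * Real.sin θ) : ℝ) : ℂ) * Complex.I) *
        Complex.I := by
    rw [← integral_complex_parts _ _ (by fun_prop) (by fun_prop),
      ← intervalIntegral.integral_mul_const]
    congr 1; funext θ
    rw [exp_sin]; push_cast; ring
  rw [l0, m0] at c0
  rw [l1, m1] at c1
  generalize (∫ θ in (0:ℝ)..(π/2), Real.cos (x * Real.sin θ)) = a0 at *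
  generalize (∫ θ in (0:ℝ)..(π/2), Real.sin (x * Real.sin θ)) = b0 at *
  generalize (∫ θ in (0:ℝ)..(π/2), Real.sin θ * Real.cos (x * Real.sin θ)) = a1 at *
  generalize (∫ θ in (0:ℝ)..(π/2), Real.sin θ * Real.sin (x * Real.sin θ)) = b1 at *
  generalize (∫ t in Set.Ioi (0:ℝ), Real.exp (-x * Real.sinh t)) = k0 at *
  generalize (∫ t in Set.Ioi (0:ℝ), Real.sinh t * Real.exp (-x * Real.sinh t)) = k1 at *
  have hEn : E.re ^ 2 + E.im ^ 2 = 1 := by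
    rw [hE, Complex.exp_ofReal_mul_I_re, Complex.exp_ofReal_mul_I_im]
    exact Real.cos_sq_add_sin_sq x
  have q1 := congrArg Complex.re c0
  have q2 := congrArg Complex.im c0
  have q3 := congrArg Complex.re c1
  have q4 := congrArg Complex.im c1
  simp at q1 q2 q3 q4
  have hk0 : k0 - b0 = E.re * A.re - E.im * A.im := by linarith
  have hk1 : a1 + k1 = -(E.re * (-A.im - B.re) - E.im * (A.re - B.im)) := by linarith
  have hb1' : b1 = -(E.re * (A.re - B.im) + E.im * (-A.im - B.re)) := by linarith
  rw [hk0, hk1, q2, hb1']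
  have : 0 < A.re * B.re + A.im * B.im := by
    have := mul_pos pA.1 pB.1
    have := mul_nonneg pA.2 pB.2
    linarith
  refine this.trans_eq ?_
  linear_combination (-(A.re * B.re + A.im * B.im)) * hEn

/-- In `besselY` the second integral is parsed inside the first one; since it is a constant,
integrated over an interval of length `π` and weighted by `1 / π`, the value is as intended. -/
lemma besselY_eq (n : ℕ) (x : ℝ) : besselY n x =
    (1 / π) * (∫ θ in (0:ℝ)..π, Real.sin (x * Real.sin θ - n * θ))
    - (1 / π) * (∫ t in Set.Ioi (0:ℝ),
        (Real.exp (n * t) + (-1 : ℝ) ^ n * Real.exp (-(n : ℝ) * t)) *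
          Real.exp (-x * Real.sinh t)) := by
  have hcs := Real.continuous_sin
  unfold besselY
  rw [intervalIntegral.integral_sub (Continuous.intervalIntegrable (by fun_prop) _ _)
    (continuous_const.intervalIntegrable _ _), intervalIntegral.integral_const]
  have := Real.pi_pos
  simp only [smul_eq_mul, sub_zero]
  field_simp

/-- For every `x > 0`,
`J₀(x)·J₁(x) + Y₀(x)·Y₁(x) > 0`. -/
theorem bessel_cross_product_pos (x : ℝ) (hx : 0 < x) :
    0 < besselJ 0 x * besselJ 1 x + besselY 0 x * besselY 1 x := by
  have hcs := Real.continuous_sin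
  have hcc := Real.continuous_cos
  have h := main_pos x hx
  have hpi := Real.pi_pos
  have j0 : besselJ 0 x = 2 / π * ∫ θ in (0:ℝ)..(π/2), Real.cos (x * Real.sin θ) := by
    unfold besselJ
    rw [fold_pi _ (by fun_prop)]
    have : ∀ θ : ℝ, Real.cos (((0:ℕ):ℝ) * θ - x * Real.sin θ) +
        Real.cos (((0:ℕ):ℝ) * (π - θ) - x * Real.sin (π - θ)) =
        2 * Real.cos (x * Real.sin θ) := by
      intro θ; rw [Real.sin_pi_sub]; simp; ring
    simp only [this]
    rw [intervalIntegral.integral_const_mul]; ring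
  have j1 : besselJ 1 x = 2 / π *
      ∫ θ in (0:ℝ)..(π/2), Real.sin θ * Real.sin (x * Real.sin θ) := by
    unfold besselJ
    rw [fold_pi _ (by fun_prop)]
    have : ∀ θ : ℝ, Real.cos (((1:ℕ):ℝ) * θ - x * Real.sin θ) +
        Real.cos (((1:ℕ):ℝ) * (π - θ) - x * Real.sin (π - θ)) =
        2 * (Real.sin θ * Real.sin (x * Real.sin θ)) := by
      intro θ
      simp only [Nat.cast_one, one_mul, Real.cos_sub, Real.sin_pi_sub]
      ring_nf
      simp
      try ring
    simp only [this]
    rw [intervalIntegral.integral_const_mul]; ring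
  have y0 : besselY 0 x = 2 / π * (∫ θ in (0:ℝ)..(π/2), Real.sin (x * Real.sin θ)) -
      2 / π * ∫ t in Set.Ioi (0:ℝ), Real.exp (-x * Real.sinh t) := by
    rw [besselY_eq, fold_pi _ (by fun_prop)]
    have : ∀ θ : ℝ, Real.sin (x * Real.sin θ - ((0:ℕ):ℝ) * θ) +
        Real.sin (x * Real.sin (π - θ) - ((0:ℕ):ℝ) * (π - θ)) =
        2 * Real.sin (x * Real.sin θ) := by
      intro θ; rw [Real.sin_pi_sub]; simp; ring
    simp only [this]
    have h2 : ∀ t : ℝ, (Real.exp (((0:ℕ):ℝ) * t) + (-1 : ℝ) ^ 0 * Real.exp (-((0:ℕ) : ℝ) * t)) *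
          Real.exp (-x * Real.sinh t) = 2 * Real.exp (-x * Real.sinh t) := by
      intro t; simp; ring
    simp only [h2]
    rw [intervalIntegral.integral_const_mul, integral_const_mul]; ring
  have y1 : besselY 1 x =
      -(2 / π * (∫ θ in (0:ℝ)..(π/2), Real.sin θ * Real.cos (x * Real.sin θ))) -
      2 / π * ∫ t in Set.Ioi (0:ℝ), Real.sinh t * Real.exp (-x * Real.sinh t) := by
    rw [besselY_eq, fold_pi _ (by fun_prop)]
    have : ∀ θ : ℝ, Real.sin (x * Real.sin θ - ((1:ℕ):ℝ) * θ) +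
        Real.sin (x * Real.sin (π - θ) - ((1:ℕ):ℝ) * (π - θ)) =
        -2 * (Real.sin θ * Real.cos (x * Real.sin θ)) := by
      intro θ
      simp only [Nat.cast_one, one_mul, Real.sin_sub, Real.sin_pi, Real.cos_pi, Real.cos_sub]
      ring_nf
    simp only [this]
    have h2 : ∀ t : ℝ, (Real.exp (((1:ℕ):ℝ) * t) + (-1 : ℝ) ^ 1 * Real.exp (-((1:ℕ) : ℝ) * t)) *
          Real.exp (-x * Real.sinh t) = 2 * (Real.sinh t * Real.exp (-x * Real.sinh t)) := by
      intro t
      have hs := Real.sinh_eq t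
      simp only [Nat.cast_one, one_mul, pow_one, neg_mul]
      linear_combination (-2 * Real.exp (-(x * Real.sinh t))) * hs
    simp only [h2]
    rw [intervalIntegral.integral_const_mul, integral_const_mul]; ring
  rw [j0, j1, y0, y1]
  have h4 : 0 < (2 / π) ^ 2 := by positivity
  refine (mul_pos h4 h).trans_eq ?_
  ring
end

section
/- Nicholson's formula in the order-0 case: for all x > 0, J₀(x)² + Y₀(x)² = (8/π²) ∫₀^∞ K₀(2x sinh t) dt, where K₀(y) = ∫₀^∞ exp(−y cosh u) du. -/
open Real MeasureTheory Filter

namespace Nich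
open Topology

lemma cont_q (x : ℝ) : Continuous (fun t : ℝ => Real.exp (-x * Real.sinh t)) := by fun_prop

lemma integrable_q {x : ℝ} (hx : 0 < x) :
    IntegrableOn (fun t : ℝ => Real.exp (-x * Real.sinh t)) (Set.Ioi 0) := by
  refine Integrable.mono' (g := fun t => Real.exp (-x * t)) (exp_neg_integrableOn_Ioi 0 hx)
    (cont_q x).aestronglyMeasurable ?_
  refine (ae_restrict_iff' measurableSet_Ioi).2 (ae_of_all _ fun t ht => ?_)
  rw [Real.norm_eq_abs, abs_of_pos (Real.exp_pos _)]
  apply Real.exp_le_exp.2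
  have : t ≤ Real.sinh t := Real.self_le_sinh_iff.2 (le_of_lt ht)
  nlinarith

/-- the total integral -/
noncomputable def A (x : ℝ) : ℝ := ∫ t in Set.Ioi (0:ℝ), Real.exp (-x * Real.sinh t)
noncomputable def Q (x t : ℝ) : ℝ := ∫ s in (0:ℝ)..t, Real.exp (-x * Real.sinh s)

lemma Q_deriv (x t : ℝ) : HasDerivAt (Q x) (Real.exp (-x * Real.sinh t)) t :=
  intervalIntegral.integral_hasDerivAt_right ((cont_q x).intervalIntegrable _ _)
    ((cont_q x).stronglyMeasurableAtFilter _ _) (cont_q x).continuousAt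

lemma Q_cont (x : ℝ) : Continuous (Q x) :=
  continuous_iff_continuousAt.2 fun t => (Q_deriv x t).continuousAt

lemma Q_zero (x : ℝ) : Q x 0 = 0 := by simp [Q]

lemma Q_tendsto {x : ℝ} (hx : 0 < x) : Tendsto (Q x) atTop (𝓝 (A x)) :=
  intervalIntegral_tendsto_integral_Ioi 0 (integrable_q hx) tendsto_id

lemma Q_nonneg (x : ℝ) {t : ℝ} (ht : 0 ≤ t) : 0 ≤ Q x t :=
  intervalIntegral.integral_nonneg ht fun _ _ => (Real.exp_pos _).le

lemma V_eq {x : ℝ} (hx : 0 < x) {t : ℝ} (ht : 0 ≤ t) :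
    A x - Q x t = ∫ s in Set.Ioi t, Real.exp (-x * Real.sinh s) := by
  rw [A, Q, ← intervalIntegral.integral_interval_add_Ioi (integrable_q hx)
    ((integrable_q hx).mono_set (Set.Ioi_subset_Ioi ht))]
  ring

lemma V_nonneg {x : ℝ} (hx : 0 < x) {t : ℝ} (ht : 0 ≤ t) : 0 ≤ A x - Q x t := by
  rw [V_eq hx ht]
  exact integral_nonneg fun _ => (Real.exp_pos _).le

lemma V_le {x : ℝ} (hx : 0 < x) {t : ℝ} (ht : 0 ≤ t) :
    A x - Q x t ≤ Real.exp (-x * Real.sinh t) / (x * Real.cosh t) := by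
  rw [V_eq hx ht]
  have hd : ∀ s ∈ Set.Ici t, HasDerivAt
      (fun s => -(Real.exp (-x * Real.sinh s) / (x * Real.cosh t)))
      (Real.exp (-x * Real.sinh s) * (Real.cosh s / Real.cosh t)) s := by
    intro s _
    have h := ((((Real.hasDerivAt_sinh s).const_mul (-x)).exp).div_const (x * Real.cosh t)).neg
    refine h.congr_deriv ?_
    have := (Real.cosh_pos t).ne'
    field_simp
  have hs : Tendsto Real.sinh atTop atTop :=
    tendsto_atTop_mono' _ (by
      filter_upwards [eventually_ge_atTop 0] with s hs using Real.self_le_sinh_iff.2 hs) tendsto_id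
  have hl : Tendsto (fun s => -(Real.exp (-x * Real.sinh s) / (x * Real.cosh t))) atTop (𝓝 0) := by
    have h1 : Tendsto (fun s => -x * Real.sinh s) atTop atBot :=
      hs.const_mul_atTop_of_neg (by linarith)
    simpa using ((Real.tendsto_exp_atBot.comp h1).div_const (x * Real.cosh t)).neg
  have hp : ∀ s ∈ Set.Ioi t, 0 ≤ Real.exp (-x * Real.sinh s) * (Real.cosh s / Real.cosh t) := by
    intro s _
    have := Real.cosh_pos t
    have := Real.cosh_pos s
    positivity
  have hi := integrableOn_Ioi_deriv_of_nonneg' hd hp hl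
  have he := integral_Ioi_of_hasDerivAt_of_nonneg' hd hp hl
  have : ∫ s in Set.Ioi t, Real.exp (-x * Real.sinh s) ≤
      ∫ s in Set.Ioi t, Real.exp (-x * Real.sinh s) * (Real.cosh s / Real.cosh t) := by
    refine setIntegral_mono_on ((integrable_q hx).mono_set (Set.Ioi_subset_Ioi ht)) hi
      measurableSet_Ioi fun s hs => ?_
    refine le_mul_of_one_le_right (Real.exp_pos _).le ?_
    rw [one_le_div (Real.cosh_pos t), Real.cosh_le_cosh, abs_of_nonneg ht,
      abs_of_nonneg (ht.trans (le_of_lt hs))]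
    exact le_of_lt hs
  rw [he] at this
  linarith

lemma sinh_tendsto : Tendsto Real.sinh atTop atTop :=
  tendsto_atTop_mono' _ (by
      filter_upwards [eventually_ge_atTop 0] with s hs using Real.self_le_sinh_iff.2 hs) tendsto_id

/-- scaled tail -/
lemma VE_le {x : ℝ} (hx : 0 < x) {t : ℝ} (ht : 0 ≤ t) :
    (A x - Q x t) * Real.exp (x * Real.sinh t) ≤ 1 / (x * Real.cosh t) := by
  calc _ ≤ Real.exp (-x * Real.sinh t) / (x * Real.cosh t) * Real.exp (x * Real.sinh t) :=
        mul_le_mul_of_nonneg_right (V_le hx ht) (Real.exp_pos _).le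
    _ = (Real.exp (-x * Real.sinh t) * Real.exp (x * Real.sinh t)) / (x * Real.cosh t) := by ring
    _ = _ := by rw [← Real.exp_add]; simp

lemma W_le {x : ℝ} (hx : 0 < x) {t : ℝ} (ht : 0 ≤ t) :
    Q (-x) t ≤ t * Real.exp (x * Real.sinh t) := by
  have h : Q (-x) t ≤ ∫ s in (0:ℝ)..t, Real.exp (x * Real.sinh t) := by
    refine intervalIntegral.integral_mono_on ht ((cont_q (-x)).intervalIntegrable _ _)
      (by simp) fun s hs => ?_
    rw [neg_neg]
    exact Real.exp_le_exp.2 (mul_le_mul_of_nonneg_left (Real.sinh_le_sinh.2 hs.2) hx.le)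
  simpa using h

lemma WV_tendsto {x : ℝ} (hx : 0 < x) :
    Tendsto (fun R => Q (-x) R * (A x - Q x R)) atTop (𝓝 0) := by
  have hb : Tendsto (fun R : ℝ => (2 / x) * (R ^ 1 * Real.exp (-R))) atTop (𝓝 0) := by
    simpa using (Real.tendsto_pow_mul_exp_neg_atTop_nhds_zero 1).const_mul (2 / x)
  refine squeeze_zero' ?_ ?_ hb
  · filter_upwards [eventually_ge_atTop 0] with R hR
    exact mul_nonneg (Q_nonneg _ hR) (V_nonneg hx hR)
  · filter_upwards [eventually_ge_atTop 0] with R hR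
    have hc : Real.exp R / 2 ≤ Real.cosh R := by
      rw [Real.cosh_eq]; have := Real.exp_pos (-R); linarith
    have hce := Real.exp_pos R
    calc Q (-x) R * (A x - Q x R) ≤ (R * Real.exp (x * Real.sinh R)) * (A x - Q x R) :=
          mul_le_mul_of_nonneg_right (W_le hx hR) (V_nonneg hx hR)
      _ = R * ((A x - Q x R) * Real.exp (x * Real.sinh R)) := by ring
      _ ≤ R * (1 / (x * Real.cosh R)) := mul_le_mul_of_nonneg_left (VE_le hx hR) hR
      _ ≤ R * (1 / (x * (Real.exp R / 2))) := by gcongr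
      _ = _ := by rw [Real.exp_neg]; field_simp

/-- integration by parts -/
lemma gh_parts (x R : ℝ) :
    (∫ t in (0:ℝ)..R, Real.exp (x * Real.sinh t) * (A x - Q x t)) -
      (∫ t in (0:ℝ)..R, Real.exp (-x * Real.sinh t) * Q (-x) t) = Q (-x) R * (A x - Q x R) := by
  have c1 := Q_cont x
  have c2 := Q_cont (-x)
  rw [← intervalIntegral.integral_sub (Continuous.intervalIntegrable (by fun_prop) _ _)
    (Continuous.intervalIntegrable (by fun_prop) _ _)]
  rw [intervalIntegral.integral_eq_sub_of_hasDerivAt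
    (f := fun t => Q (-x) t * (A x - Q x t))]
  · simp [Q_zero]
  · intro t _
    have h := (Q_deriv (-x) t).mul ((Q_deriv x t).const_sub (A x))
    refine h.congr_deriv ?_
    rw [neg_neg]; ring
  · exact Continuous.intervalIntegrable (by fun_prop) _ _

/-! ### Complex part -/

lemma exists_prim (x : ℝ) : ∃ P : ℂ → ℂ, P 0 = 0 ∧
    ∀ z, HasDerivAt P (Complex.exp (-x * Complex.sinh z)) z := by
  have hd : Differentiable ℂ (fun z : ℂ => Complex.exp (-x * Complex.sinh z)) := by
    fun_prop
  obtain ⟨P, hP⟩ := hd.isExactOn_univ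
  refine ⟨fun z => P z - P 0, by simp, fun z => ?_⟩
  exact (hP z (Set.mem_univ z)).sub_const _

lemma prim_line {x : ℝ} {P : ℂ → ℂ} (hP : ∀ z, HasDerivAt P (Complex.exp (-x * Complex.sinh z)) z)
    (z c : ℂ) (t : ℝ) :
    P (z + t * c) = P z + c * ∫ s in (0:ℝ)..t, Complex.exp (-x * Complex.sinh (z + s * c)) := by
  have h : ∫ s in (0:ℝ)..t, c * Complex.exp (-x * Complex.sinh (z + s * c)) =
      P (z + (t:ℝ) * c) - P (z + (0:ℝ) * c) := by
    refine intervalIntegral.integral_eq_sub_of_hasDerivAt (f := fun s : ℝ => P (z + s * c)) ?_ ?_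
    · intro s _
      have h1 : HasDerivAt (fun s : ℝ => z + (s:ℂ) * c) c s := by
        simpa using ((Complex.ofRealCLM.hasDerivAt (x := s)).mul_const c).const_add z
      have h2 := (hP (z + s * c)).comp_of_eq s h1 rfl
      simpa [mul_comm, Function.comp_def] using h2
    · exact Continuous.intervalIntegrable (by fun_prop) _ _
  rw [intervalIntegral.integral_const_mul] at h
  rw [h]; simp

lemma sinh_line (t θ : ℝ) : Complex.sinh (t + θ * Complex.I) =
    (Real.sinh t * Real.cos θ : ℝ) + (Real.cosh t * Real.sin θ : ℝ) * Complex.I := by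
  rw [Complex.sinh_add, Complex.sinh_mul_I, Complex.cosh_mul_I]
  push_cast; ring

lemma sinh_im (θ : ℝ) : Complex.sinh (θ * Complex.I) = (Real.sin θ : ℝ) * Complex.I := by
  simp [Complex.sinh_mul_I]

lemma sinh_pi (t : ℝ) : Complex.sinh (t + (π:ℝ) * Complex.I) = -(Real.sinh t : ℝ) := by
  rw [sinh_line]; simp

lemma P_real {x : ℝ} {P : ℂ → ℂ} (hP : ∀ z, HasDerivAt P (Complex.exp (-x * Complex.sinh z)) z)
    (h0 : P 0 = 0) (t : ℝ) : P t = (Q x t : ℝ) := by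
  have h := prim_line hP 0 1 t
  simp only [zero_add, mul_one, one_mul, h0] at h
  rw [h, Q, ← intervalIntegral.integral_ofReal]
  push_cast; rfl

lemma P_pi {x : ℝ} {P : ℂ → ℂ} (hP : ∀ z, HasDerivAt P (Complex.exp (-x * Complex.sinh z)) z)
    (t : ℝ) : P (t + (π:ℝ) * Complex.I) = P ((π:ℝ) * Complex.I) + (Q (-x) t : ℝ) := by
  have h := prim_line hP ((π:ℝ) * Complex.I) 1 t
  simp only [mul_one, one_mul] at h
  rw [add_comm, h, Q, ← intervalIntegral.integral_ofReal]
  congr 1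
  refine intervalIntegral.integral_congr fun s _ => ?_
  rw [add_comm, sinh_pi]
  push_cast; ring_nf

noncomputable def Cc (x t : ℝ) : ℝ := ∫ s in (0:ℝ)..t, Real.cos (x * Real.sin s)
noncomputable def Dd (x t : ℝ) : ℝ := ∫ s in (0:ℝ)..t, Real.sin (x * Real.sin s)

lemma Cc_deriv (x t : ℝ) : HasDerivAt (Cc x) (Real.cos (x * Real.sin t)) t := by
  have c : Continuous (fun t => Real.cos (x * Real.sin t)) := by fun_prop
  exact intervalIntegral.integral_hasDerivAt_right (c.intervalIntegrable _ _)
    (c.stronglyMeasurableAtFilter _ _) c.continuousAt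

lemma Dd_deriv (x t : ℝ) : HasDerivAt (Dd x) (Real.sin (x * Real.sin t)) t := by
  have c : Continuous (fun t => Real.sin (x * Real.sin t)) := by fun_prop
  exact intervalIntegral.integral_hasDerivAt_right (c.intervalIntegrable _ _)
    (c.stronglyMeasurableAtFilter _ _) c.continuousAt

lemma P_im {x : ℝ} {P : ℂ → ℂ} (hP : ∀ z, HasDerivAt P (Complex.exp (-x * Complex.sinh z)) z)
    (h0 : P 0 = 0) (t : ℝ) : P (t * Complex.I) = (Dd x t : ℝ) + (Cc x t : ℝ) * Complex.I := by
  have h := prim_line hP 0 Complex.I t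
  simp only [zero_add, h0] at h
  have h2 : ∫ s in (0:ℝ)..t, Complex.exp (-x * Complex.sinh (s * Complex.I)) =
      (Cc x t : ℝ) - (Dd x t : ℝ) * Complex.I := by
    rw [Cc, Dd, ← intervalIntegral.integral_ofReal, ← intervalIntegral.integral_ofReal,
      ← intervalIntegral.integral_mul_const, ← intervalIntegral.integral_sub]
    · refine intervalIntegral.integral_congr fun s _ => ?_
      rw [sinh_im, show -(x:ℂ) * ((Real.sin s : ℝ) * Complex.I) =
        ((-(x * Real.sin s) : ℝ) : ℂ) * Complex.I by push_cast; ring, Complex.exp_mul_I,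
        ← Complex.ofReal_cos, ← Complex.ofReal_sin, Real.cos_neg, Real.sin_neg]
      push_cast; ring
    · exact Continuous.intervalIntegrable (by fun_prop) _ _
    · exact Continuous.intervalIntegrable (by fun_prop) _ _
  rw [h, h2]
  ring_nf
  simp


lemma rect_id {x : ℝ} {P : ℂ → ℂ} (hP : ∀ z, HasDerivAt P (Complex.exp (-x * Complex.sinh z)) z)
    (h0 : P 0 = 0) (R : ℝ) :
    (∫ t in (0:ℝ)..R, Real.exp (x * Real.sinh t) * (A x - Q x t)) +
      (∫ t in (0:ℝ)..R, Real.exp (-x * Real.sinh t) * Q (-x) t) =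
    (A x - Dd x π) * Q x R - A x * Dd x π + (Cc x π ^ 2 + Dd x π ^ 2) / 2 -
      (Complex.I * ∫ θ in (0:ℝ)..π, Complex.exp (x * Complex.sinh (R + θ * Complex.I)) *
        (A x - P (R + θ * Complex.I))).re := by
  have hPd : Differentiable ℂ P := fun z => (hP z).differentiableAt
  have hPc := hPd.continuous
  have hf : Differentiable ℂ (fun z : ℂ => Complex.exp (x * Complex.sinh z) * (A x - P z)) := by
    fun_prop
  have hr := Complex.integral_boundary_rect_eq_zero_of_differentiableOn _ 0 (R + (π:ℝ) * Complex.I)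
    hf.differentiableOn
  have e1 : ((R:ℂ) + (π:ℝ) * Complex.I).re = R := by simp
  have e2 : ((R:ℂ) + (π:ℝ) * Complex.I).im = π := by simp
  rw [e1, e2] at hr
  simp only [Complex.zero_re, Complex.zero_im, Complex.ofReal_zero, zero_mul, add_zero, zero_add,
    smul_eq_mul] at hr
  have i1 : ∫ t in (0:ℝ)..R, Complex.exp (x * Complex.sinh t) * (A x - P t) =
      ((∫ t in (0:ℝ)..R, Real.exp (x * Real.sinh t) * (A x - Q x t) : ℝ) : ℂ) := by
    rw [← intervalIntegral.integral_ofReal]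
    refine intervalIntegral.integral_congr fun t _ => ?_
    simp only [P_real hP h0]
    push_cast; rfl
  have c2 := Q_cont (-x)
  have i2 : ∫ t in (0:ℝ)..R, Complex.exp (x * Complex.sinh (t + (π:ℝ) * Complex.I)) *
        (A x - P (t + (π:ℝ) * Complex.I)) =
      (A x - Dd x π - Cc x π * Complex.I) * (Q x R : ℝ) -
      ((∫ t in (0:ℝ)..R, Real.exp (-x * Real.sinh t) * Q (-x) t : ℝ) : ℂ) := by
    rw [Q, ← intervalIntegral.integral_ofReal, ← intervalIntegral.integral_ofReal,
      ← intervalIntegral.integral_const_mul, ← intervalIntegral.integral_sub]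
    · refine intervalIntegral.integral_congr fun t _ => ?_
      simp only [P_pi hP, P_im hP h0, sinh_pi]
      push_cast
      rw [show (x:ℂ) * -Complex.sinh t = -x * Complex.sinh t by ring]
      ring
    · exact Continuous.intervalIntegrable (by fun_prop) _ _
    · exact Continuous.intervalIntegrable (by fun_prop) _ _
  have i4 : (Complex.I * ∫ θ in (0:ℝ)..π, Complex.exp (x * Complex.sinh (θ * Complex.I)) *
        (A x - P (θ * Complex.I))).re =
        (Cc x π ^ 2 + Dd x π ^ 2) / 2 - A x * Dd x π := by
    rw [← intervalIntegral.integral_const_mul]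
    have hi : IntervalIntegrable (fun θ : ℝ => Complex.I * (Complex.exp (x * Complex.sinh (θ * Complex.I)) *
        (A x - P (θ * Complex.I)))) volume 0 π := Continuous.intervalIntegrable (by fun_prop) _ _
    have := Complex.reCLM.intervalIntegral_comp_comm hi
    simp only [Complex.reCLM_apply] at this
    rw [← this]
    have cc : Continuous (Cc x) := continuous_iff_continuousAt.2 fun t => (Cc_deriv x t).continuousAt
    have cd : Continuous (Dd x) := continuous_iff_continuousAt.2 fun t => (Dd_deriv x t).continuousAt
    rw [intervalIntegral.integral_congr (g := fun θ => Real.cos (x * Real.sin θ) * Cc x θ -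
      Real.sin (x * Real.sin θ) * (A x - Dd x θ))]
    · rw [intervalIntegral.integral_eq_sub_of_hasDerivAt
        (f := fun θ => (Cc x θ ^ 2 + Dd x θ ^ 2) / 2 - A x * Dd x θ)]
      · simp [Cc, Dd]
      · intro θ _
        have h := ((((Cc_deriv x θ).pow 2).add ((Dd_deriv x θ).pow 2)).div_const 2).sub
          ((Dd_deriv x θ).const_mul (A x))
        refine h.congr_deriv ?_
        simp; ring
      · exact Continuous.intervalIntegrable (by fun_prop) _ _
    · intro θ _
      simp only [P_im hP h0, sinh_im]
      rw [show (x:ℂ) * ((Real.sin θ : ℝ) * Complex.I) =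
        (((x * Real.sin θ) : ℝ) : ℂ) * Complex.I by push_cast; ring, Complex.exp_mul_I,
        ← Complex.ofReal_cos, ← Complex.ofReal_sin]
      simp only [Complex.mul_re, Complex.mul_im, Complex.add_re, Complex.add_im, Complex.sub_re,
        Complex.sub_im, Complex.I_re, Complex.I_im, Complex.ofReal_re, Complex.ofReal_im]
      ring
  rw [i1, i2] at hr
  have hr2 := congrArg Complex.re hr
  rw [Complex.sub_re, i4, Complex.add_re] at hr2
  simp only [Complex.mul_re (_ - _), Complex.sub_re, Complex.sub_im,
    Complex.ofReal_re, Complex.ofReal_im, mul_zero, Complex.re_ofReal_mul, Complex.I_re,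
    Complex.zero_re, sub_zero] at hr2
  linarith

lemma norm_E (x R θ : ℝ) : ‖Complex.exp (x * Complex.sinh (R + θ * Complex.I))‖ =
    Real.exp (x * (Real.sinh R * Real.cos θ)) := by
  rw [Complex.norm_exp, sinh_line, Complex.re_ofReal_mul]
  simp only [Complex.add_re, Complex.ofReal_re, Complex.re_ofReal_mul, Complex.I_re, mul_zero,
    add_zero]

/-- the kernel on the vertical side -/
noncomputable def ker (x R θ : ℝ) : ℝ :=
  ∫ τ in (0:ℝ)..θ, Real.exp (x * (Real.sinh R * (Real.cos θ - Real.cos τ)))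

lemma side_bound {x : ℝ} (hx : 0 < x) {P : ℂ → ℂ}
    (hP : ∀ z, HasDerivAt P (Complex.exp (-x * Complex.sinh z)) z)
    (h0 : P 0 = 0) {R : ℝ} (hR : 0 ≤ R) {θ : ℝ} (hθ : 0 ≤ θ) :
    ‖Complex.exp (x * Complex.sinh (R + θ * Complex.I)) * (A x - P (R + θ * Complex.I))‖ ≤
      1 / (x * Real.cosh R) + ker x R θ := by
  rw [prim_line hP, P_real hP h0, ← sub_sub, mul_sub]
  refine (norm_sub_le _ _).trans (add_le_add ?_ ?_)
  · rw [norm_mul, norm_E, ← Complex.ofReal_sub, Complex.norm_real, Real.norm_eq_abs,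
      abs_of_nonneg (V_nonneg hx hR), mul_comm]
    refine le_trans (mul_le_mul_of_nonneg_left ?_ (V_nonneg hx hR)) (VE_le hx hR)
    apply Real.exp_le_exp.2
    have h1 := Real.sinh_nonneg_iff.2 hR
    have h2 := Real.cos_le_one θ
    exact mul_le_mul_of_nonneg_left (mul_le_of_le_one_right h1 h2) hx.le
  · rw [← mul_assoc, mul_comm _ Complex.I, mul_assoc, norm_mul, Complex.norm_I, one_mul,
      ← intervalIntegral.integral_const_mul]
    refine (intervalIntegral.norm_integral_le_integral_norm hθ).trans (le_of_eq ?_)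
    refine intervalIntegral.integral_congr fun τ _ => ?_
    rw [norm_mul, norm_E]
    have := norm_E (-x) R τ
    push_cast at this
    rw [this, ← Real.exp_add]
    ring_nf

lemma ker_bound {x : ℝ} (hx : 0 < x) {R : ℝ} (hR : 0 ≤ R) {θ τ : ℝ} (h0 : 0 ≤ τ) (h1 : τ ≤ θ)
    (h2 : θ ≤ π) : Real.exp (x * (Real.sinh R * (Real.cos θ - Real.cos τ))) ≤ 1 := by
  rw [Real.exp_le_one_iff]
  have := Real.cos_le_cos_of_nonneg_of_le_pi h0 h2 h1
  have h3 := Real.sinh_nonneg_iff.2 hR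
  exact mul_nonpos_of_nonneg_of_nonpos hx.le (mul_nonpos_of_nonneg_of_nonpos h3 (by linarith))

lemma ker_nonneg (x R : ℝ) {θ : ℝ} (h : 0 ≤ θ) : 0 ≤ ker x R θ :=
  intervalIntegral.integral_nonneg h fun _ _ => (Real.exp_pos _).le

lemma ker_le {x : ℝ} (hx : 0 < x) {R : ℝ} (hR : 0 ≤ R) {θ : ℝ} (h : 0 ≤ θ) (h2 : θ ≤ π) :
    ker x R θ ≤ π := by
  have : ker x R θ ≤ ∫ τ in (0:ℝ)..θ, (1:ℝ) := by
    refine intervalIntegral.integral_mono_on h (Continuous.intervalIntegrable (by fun_prop) _ _)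
      (by simp) fun s hs => ker_bound hx hR hs.1 hs.2 h2
  simp at this
  linarith

lemma ker_tendsto {x : ℝ} (hx : 0 < x) {θ : ℝ} (h : 0 ≤ θ) (h2 : θ ≤ π) :
    Tendsto (fun R => ker x R θ) atTop (𝓝 0) := by
  have : Tendsto (fun R => ker x R θ) atTop (𝓝 (∫ τ in (0:ℝ)..θ, (0:ℝ))) := by
    refine intervalIntegral.tendsto_integral_filter_of_dominated_convergence (fun _ => (1:ℝ))
      (.of_forall fun R => Continuous.aestronglyMeasurable (by fun_prop)) ?_ (by simp) ?_
    · filter_upwards [eventually_ge_atTop 0] with R hR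
      refine ae_of_all _ fun τ hτ => ?_
      rw [Set.uIoc_of_le h] at hτ
      rw [Real.norm_eq_abs, abs_of_pos (Real.exp_pos _)]
      exact ker_bound hx hR hτ.1.le hτ.2 h2
    · have hne : ∀ᵐ τ : ℝ, τ ≠ θ := by simp [ae_iff]
      filter_upwards [hne] with τ hτn hτ
      rw [Set.uIoc_of_le h] at hτ
      have hlt : τ < θ := lt_of_le_of_ne hτ.2 hτn
      have hc := Real.cos_lt_cos_of_nonneg_of_le_pi hτ.1.le h2 hlt
      refine Real.tendsto_exp_atBot.comp ?_
      refine Tendsto.const_mul_atBot hx ?_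
      exact sinh_tendsto.atTop_mul_const_of_neg (by linarith)
  simpa using this

lemma side_tendsto {x : ℝ} (hx : 0 < x) {P : ℂ → ℂ}
    (hP : ∀ z, HasDerivAt P (Complex.exp (-x * Complex.sinh z)) z) (h0 : P 0 = 0) :
    Tendsto (fun R : ℝ => ∫ θ in (0:ℝ)..π, Complex.exp (x * Complex.sinh (R + θ * Complex.I)) *
        (A x - P (R + θ * Complex.I))) atTop (𝓝 0) := by
  have hPd : Differentiable ℂ P := fun z => (hP z).differentiableAt
  have hPc := hPd.continuous
  have : Tendsto (fun R : ℝ => ∫ θ in (0:ℝ)..π, Complex.exp (x * Complex.sinh (R + θ * Complex.I)) *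
        (A x - P (R + θ * Complex.I))) atTop (𝓝 (∫ θ in (0:ℝ)..π, (0:ℂ))) := by
    refine intervalIntegral.tendsto_integral_filter_of_dominated_convergence
      (fun _ => 1 / x + π)
      (.of_forall fun R => Continuous.aestronglyMeasurable (by fun_prop)) ?_ (by simp) ?_
    · filter_upwards [eventually_ge_atTop 0] with R hR
      refine ae_of_all _ fun θ hθ => ?_
      rw [Set.uIoc_of_le Real.pi_pos.le] at hθ
      refine (side_bound hx hP h0 hR hθ.1.le).trans (add_le_add ?_ (ker_le hx hR hθ.1.le hθ.2))
      exact one_div_le_one_div_of_le hx (le_mul_of_one_le_right hx.le (Real.one_le_cosh R))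
    · refine ae_of_all _ fun θ hθ => ?_
      rw [Set.uIoc_of_le Real.pi_pos.le] at hθ
      have hc : Tendsto Real.cosh atTop atTop :=
        tendsto_atTop_mono (fun R => (Real.sinh_lt_cosh R).le) sinh_tendsto
      have hl : Tendsto (fun R => 1 / (x * Real.cosh R) + ker x R θ) atTop (𝓝 0) := by
        have := (tendsto_inv_atTop_zero.comp (hc.const_mul_atTop hx)).add
          (ker_tendsto hx hθ.1.le hθ.2)
        simpa [Function.comp_def] using this
      refine squeeze_zero_norm' ?_ hl
      filter_upwards [eventually_ge_atTop 0] with R hR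
      exact side_bound hx hP h0 hR hθ.1.le
  simpa using this

lemma h_tendsto {x : ℝ} (hx : 0 < x) :
    Tendsto (fun R => ∫ t in (0:ℝ)..R, Real.exp (-x * Real.sinh t) * Q (-x) t) atTop
      (𝓝 ((A x ^ 2 - 2 * A x * Dd x π + (Cc x π ^ 2 + Dd x π ^ 2) / 2) / 2)) := by
  obtain ⟨P, h0, hP⟩ := exists_prim x
  have hs := (Complex.continuous_re.tendsto _).comp ((side_tendsto hx hP h0).const_mul Complex.I)
  have hq := (Q_tendsto hx).const_mul (A x - Dd x π)
  have := ((((hq.sub_const (A x * Dd x π)).add_const ((Cc x π ^ 2 + Dd x π ^ 2) / 2)).sub hs).sub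
    (WV_tendsto hx)).div_const 2
  refine (this.congr fun R => ?_).trans (le_of_eq ?_)
  · rw [← gh_parts]
    have := rect_id hP h0 R
    simp only [Function.comp]
    linarith
  · congr 1; simp; ring

lemma h_integrable {x : ℝ} (hx : 0 < x) :
    IntegrableOn (fun t => Real.exp (-x * Real.sinh t) * Q (-x) t) (Set.Ioi 0) := by
  have c2 := Q_cont (-x)
  refine integrableOn_Ioi_of_intervalIntegral_norm_tendsto _ 0
    (fun R => (Continuous.integrableOn_Icc (by fun_prop)).mono_set Set.Ioc_subset_Icc_self)
    tendsto_id ((h_tendsto hx).congr' ?_)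
  filter_upwards [eventually_ge_atTop 0] with R hR
  refine intervalIntegral.integral_congr fun t ht => ?_
  rw [Set.uIcc_of_le hR] at ht
  rw [Real.norm_eq_abs, abs_of_nonneg (mul_nonneg (Real.exp_pos _).le (Q_nonneg _ ht.1))]

lemma h_integral {x : ℝ} (hx : 0 < x) :
    ∫ t in Set.Ioi (0:ℝ), Real.exp (-x * Real.sinh t) * Q (-x) t =
      (A x ^ 2 - 2 * A x * Dd x π + (Cc x π ^ 2 + Dd x π ^ 2) / 2) / 2 :=
  tendsto_nhds_unique (intervalIntegral_tendsto_integral_Ioi 0 (h_integrable hx) tendsto_id)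
    (h_tendsto hx)

lemma qQ_deriv {x : ℝ} (t : ℝ) : HasDerivAt (fun t => Q x t ^ 2 / 2)
    (Real.exp (-x * Real.sinh t) * Q x t) t :=
  (((Q_deriv x t).pow 2).div_const 2).congr_deriv (by simp; ring)

lemma qQ_integrable {x : ℝ} (hx : 0 < x) :
    IntegrableOn (fun t => Real.exp (-x * Real.sinh t) * Q x t) (Set.Ioi 0) :=
  integrableOn_Ioi_deriv_of_nonneg' (fun t _ => qQ_deriv t)
    (fun t ht => mul_nonneg (Real.exp_pos _).le (Q_nonneg _ (le_of_lt ht)))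
    (((Q_tendsto hx).pow 2).div_const 2)

lemma qQ_integral {x : ℝ} (hx : 0 < x) :
    ∫ t in Set.Ioi (0:ℝ), Real.exp (-x * Real.sinh t) * Q x t = A x ^ 2 / 2 := by
  rw [integral_Ioi_of_hasDerivAt_of_nonneg' (fun t _ => qQ_deriv t)
    (fun t ht => mul_nonneg (Real.exp_pos _).le (Q_nonneg _ (le_of_lt ht)))
    (((Q_tendsto hx).pow 2).div_const 2)]
  simp [Q_zero]

noncomputable def kk (x t a : ℝ) : ℝ := Real.exp (-x * Real.sinh a) * Real.exp (-x * Real.sinh (2 * t - a))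

noncomputable def GG (x : ℝ) (p : ℝ × ℝ) : ℝ :=
  Set.indicator {p : ℝ × ℝ | 0 < p.1 ∧ p.1 < p.2} (fun p => kk x p.1 p.2) p

lemma GG_nonneg (x : ℝ) (p : ℝ × ℝ) : 0 ≤ GG x p :=
  Set.indicator_nonneg (fun _ _ => mul_nonneg (Real.exp_pos _).le (Real.exp_pos _).le) p

lemma GG_meas (x : ℝ) : Measurable (GG x) := by
  have hs : MeasurableSet {p : ℝ × ℝ | 0 < p.1 ∧ p.1 < p.2} :=
    (measurableSet_lt measurable_const measurable_fst).inter
      (measurableSet_lt measurable_fst measurable_snd)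
  refine Measurable.indicator ?_ hs
  refine Continuous.measurable ?_
  unfold kk
  fun_prop

lemma GG_sec (x a : ℝ) : (fun t => GG x (t, a)) = Set.indicator (Set.Ioo 0 a) (fun t => kk x t a) := by
  ext t
  simp only [GG, Set.indicator, Set.mem_ofPred_eq, Set.mem_Ioo]

lemma kk_cont (x a : ℝ) : Continuous (fun t => kk x t a) := by
  unfold kk; fun_prop

lemma GG_sec_int (x a : ℝ) : Integrable (fun t => GG x (t, a)) := by
  rw [GG_sec, integrable_indicator_iff measurableSet_Ioo]
  exact ((kk_cont x a).integrableOn_Icc).mono_set Set.Ioo_subset_Icc_self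

lemma GG_sec_val (x a : ℝ) : ∫ t, GG x (t, a) = Set.indicator (Set.Ioi 0) (fun a =>
    (1 / 2) * (Real.exp (-x * Real.sinh a) * Q x a + Real.exp (-x * Real.sinh a) * Q (-x) a)) a := by
  rw [GG_sec, integral_indicator measurableSet_Ioo]
  by_cases ha : 0 < a
  · rw [Set.indicator_of_mem (Set.mem_Ioi.2 ha), ← integral_Ioc_eq_integral_Ioo,
      ← intervalIntegral.integral_of_le ha.le]
    unfold kk
    rw [intervalIntegral.integral_const_mul,
      intervalIntegral.integral_comp_mul_sub (fun b => Real.exp (-x * Real.sinh b)) two_ne_zero,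
      ← intervalIntegral.integral_add_adjacent_intervals (b := 0)
        ((cont_q x).intervalIntegrable _ _) ((cont_q x).intervalIntegrable _ _)]
    have h1 : ∫ b in (2 * 0 - a)..0, Real.exp (-x * Real.sinh b) = Q (-x) a := by
      rw [Q]
      have := intervalIntegral.integral_comp_neg (a := 0) (b := a)
        (fun b => Real.exp (-x * Real.sinh b))
      simp only [Real.sinh_neg, neg_zero] at this
      rw [show 2 * 0 - a = -a by ring, ← this]
      simp
    rw [h1, show 2 * a - a = a by ring, ← Q]
    simp; ring
  · rw [Set.Ioo_eq_empty ha, Set.indicator_of_notMem (by simpa using ha)]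
    simp

lemma GG_int {x : ℝ} (hx : 0 < x) : Integrable (GG x) (volume.prod volume) := by
  rw [integrable_prod_iff' (GG_meas x).aestronglyMeasurable]
  refine ⟨ae_of_all _ fun a => GG_sec_int x a, ?_⟩
  simp only [Real.norm_eq_abs, abs_of_nonneg (GG_nonneg x _), GG_sec_val]
  rw [integrable_indicator_iff measurableSet_Ioi]
  exact ((qQ_integrable hx).add (h_integrable hx)).const_mul (1 / 2)

lemma K_sec (x t : ℝ) : ∫ a, GG x (t, a) =
    Set.indicator (Set.Ioi 0) (fun t => besselK 0 (2 * x * Real.sinh t)) t := by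
  by_cases ht : 0 < t
  · rw [Set.indicator_of_mem (Set.mem_Ioi.2 ht), besselK, ← integral_indicator measurableSet_Ioi,
      ← integral_add_right_eq_self _ t]
    refine integral_congr_ae (ae_of_all _ fun u => ?_)
    simp only [GG, Set.indicator, Set.mem_ofPred_eq, Set.mem_Ioi, ht, true_and, lt_add_iff_pos_left]
    split_ifs with hu
    · rw [kk, ← Real.exp_add, show 2 * t - (u + t) = t - u by ring, Real.sinh_add, Real.sinh_sub]
      simp
      ring
    · rfl
  · rw [Set.indicator_of_notMem (by simpa using ht)]
    have : (fun a => GG x (t, a)) = fun _ => 0 := by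
      ext a
      simp [GG, ht]
    rw [this]; simp

lemma K_integral {x : ℝ} (hx : 0 < x) :
    ∫ t in Set.Ioi (0:ℝ), besselK 0 (2 * x * Real.sinh t) =
      (1 / 2) * (A x ^ 2 / 2 +
        (A x ^ 2 - 2 * A x * Dd x π + (Cc x π ^ 2 + Dd x π ^ 2) / 2) / 2) := by
  have hsw := integral_integral_swap (f := fun t a => GG x (t, a)) (GG_int hx)
  simp only [K_sec, GG_sec_val] at hsw
  rw [integral_indicator measurableSet_Ioi, integral_indicator measurableSet_Ioi,
    integral_const_mul, integral_add (qQ_integrable hx) (h_integrable hx), qQ_integral hx,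
    h_integral hx] at hsw
  exact hsw

end Nich

/-- Nicholson's formula in the order-0 case: for all `x > 0`,
`J₀(x)² + Y₀(x)² = (8/π²) ∫₀^∞ K₀(2x sinh t) dt`. -/
theorem nicholson_order_zero (x : ℝ) (hx : 0 < x) :
    besselJ 0 x ^ 2 + besselY 0 x ^ 2 =
      (8 / π ^ 2) * ∫ t in Set.Ioi (0:ℝ), besselK 0 (2 * x * Real.sinh t) := by
  rw [Nich.K_integral hx]
  have hJ : besselJ 0 x = (1 / π) * Nich.Cc x π := by
    simp [besselJ, Nich.Cc]
  have hA : ∫ t in Set.Ioi (0:ℝ),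
        (Real.exp ((0:ℕ) * t) + (-1 : ℝ) ^ 0 * Real.exp (-((0:ℕ) : ℝ) * t)) *
          Real.exp (-x * Real.sinh t) = 2 * Nich.A x := by
    rw [Nich.A, ← integral_const_mul]
    refine integral_congr_ae (ae_of_all _ fun t => ?_)
    simp
    norm_num
  have hY : besselY 0 x = (1 / π) * (Nich.Dd x π - 2 * Nich.A x) := by
    rw [besselY, hA, intervalIntegral.integral_sub
      (Continuous.intervalIntegrable (by fun_prop) _ _) (by simp)]
    simp only [Nich.Dd, intervalIntegral.integral_const, Nat.cast_zero, zero_mul, sub_zero,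
      smul_eq_mul]
    field_simp
  rw [hJ, hY]
  field_simp
  ring
end

section
/- Define g(y) = (λ/k) · |J₀(ky)| / √(J₀(ky + kξ)² + Y₀(ky + kξ)²) for y ≥ 0, with constants λ > 0, k > 0, ξ > 0. Then g'(0) > 0. -/
open Real MeasureTheory Filter

/-- The phase function along the steepest-descent contour. -/
noncomputable def sdTau (v : ℝ) : ℝ := Real.cosh v - 1 / Real.cosh v

lemma sdTau_cont : Continuous sdTau := by
  unfold sdTau
  exact Real.continuous_cosh.sub
    (continuous_const.div Real.continuous_cosh (fun v => (Real.cosh_pos v).ne'))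

lemma sdTau_pos {v : ℝ} (hv : 0 < v) : 0 < sdTau v := by
  unfold sdTau
  have h1 : 1 < Real.cosh v := Real.one_lt_cosh.2 hv.ne'
  have : 1 / Real.cosh v < 1 := by
    rw [div_lt_one (by linarith)]; exact h1
  linarith

lemma sdTau_ge (v : ℝ) (hv : 0 ≤ v) : v - 1 ≤ sdTau v := by
  unfold sdTau
  have h1 : 1 ≤ Real.cosh v := Real.one_le_cosh v
  have h2 : 1 / Real.cosh v ≤ 1 := by
    rw [div_le_one (by linarith)]; exact h1
  have h3 : v ≤ Real.sinh v := Real.self_le_sinh_iff.2 hv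
  have h4 := Real.sinh_lt_cosh v
  linarith

lemma sd_bound_integrable (c C : ℝ) (hc : 0 < c) :
    IntegrableOn (fun v : ℝ => C * Real.exp (-c * v)) (Set.Ioi 0) :=
  (exp_neg_integrableOn_Ioi 0 hc).const_mul C

lemma sd_exp_le (c : ℝ) (hc : 0 < c) (v : ℝ) (hv : 0 ≤ v) :
    Real.exp (-c * sdTau v) ≤ Real.exp c * Real.exp (-c * v) := by
  rw [← Real.exp_add]
  apply Real.exp_le_exp.2
  have := sdTau_ge v hv
  nlinarith

lemma sd_integrable (w : ℝ → ℝ) (hw : Continuous w) (hw0 : ∀ v, 0 < w v) (hw1 : ∀ v, w v ≤ 1)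
    (x : ℝ) (hx : 0 < x) :
    IntegrableOn (fun v : ℝ => w v * Real.exp (-x * sdTau v)) (Set.Ioi 0) := by
  have := sdTau_cont
  refine Integrable.mono' (sd_bound_integrable x (Real.exp x) hx)
    (Continuous.aestronglyMeasurable (by fun_prop)) ?_
  filter_upwards [self_mem_ae_restrict measurableSet_Ioi] with v hv
  have hv' : 0 < v := hv
  rw [Real.norm_of_nonneg (by have := hw0 v; positivity)]
  calc w v * Real.exp (-x * sdTau v) ≤ 1 * Real.exp (-x * sdTau v) := by
        gcongr; exact hw1 v
    _ ≤ _ := by rw [one_mul]; exact sd_exp_le x hx v hv'.le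

lemma sd_pos (f : ℝ → ℝ) (hf : IntegrableOn f (Set.Ioi 0)) (hp : ∀ v, 0 < v → 0 < f v) :
    0 < ∫ v in Set.Ioi (0:ℝ), f v := by
  rw [setIntegral_pos_iff_support_of_nonneg_ae _ hf]
  · have : Function.support f ∩ Set.Ioi 0 = Set.Ioi 0 := by
      apply Set.inter_eq_right.2
      intro v hv
      exact (hp v hv).ne'
    rw [this]; simp
  · filter_upwards [self_mem_ae_restrict measurableSet_Ioi] with v hv
    exact (hp v hv).le

lemma sd_deriv (w : ℝ → ℝ) (hw : Continuous w) (hw0 : ∀ v, 0 < w v) (hw1 : ∀ v, w v ≤ 1)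
    (x : ℝ) (hx : 0 < x) :
    ∃ D < 0, HasDerivAt (fun x : ℝ => ∫ v in Set.Ioi (0:ℝ), w v * Real.exp (-x * sdTau v)) D x := by
  have hc := sdTau_cont
  have key := hasDerivAt_integral_of_dominated_loc_of_deriv_le
    (μ := volume.restrict (Set.Ioi (0:ℝ))) (s := Set.Ioi (x/2)) (x₀ := x)
    (F := fun x v => w v * Real.exp (-x * sdTau v))
    (F' := fun x v => w v * (Real.exp (-x * sdTau v) * (-sdTau v)))
    (bound := fun v => (4 / x * Real.exp (x/4)) * Real.exp (-(x/4) * v))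
    (Ioi_mem_nhds (by linarith))
    (Eventually.of_forall fun y => Continuous.aestronglyMeasurable (by fun_prop))
    (sd_integrable w hw hw0 hw1 x hx)
    (Continuous.aestronglyMeasurable (by fun_prop))
    (by
      filter_upwards [self_mem_ae_restrict measurableSet_Ioi] with v hv y hy
      have hv' : 0 < v := hv
      have hy' : x / 2 < y := hy
      have ht := sdTau_pos hv'
      have hwv := hw0 v
      rw [norm_mul, norm_mul, norm_neg, Real.norm_of_nonneg hwv.le, Real.norm_of_nonneg ht.le,
        Real.norm_of_nonneg (Real.exp_pos _).le]
      have e1 : Real.exp (-y * sdTau v) ≤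
          Real.exp (-(x/4) * sdTau v) * Real.exp (-(x/4) * sdTau v) := by
        rw [← Real.exp_add]; apply Real.exp_le_exp.2; nlinarith
      have e2 : Real.exp (-(x/4) * sdTau v) * sdTau v ≤ 4 / x := by
        have h1 := Real.add_one_le_exp (x/4 * sdTau v)
        have h2 : Real.exp (-(x/4) * sdTau v) * Real.exp (x/4 * sdTau v) = 1 := by
          rw [← Real.exp_add]; simp
        rw [le_div_iff₀ hx]
        have h3 := Real.exp_pos (-(x/4) * sdTau v)
        nlinarith [mul_le_mul_of_nonneg_left h1 h3.le]
      have e3 := sd_exp_le (x/4) (by linarith) v hv'.le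
      calc w v * (Real.exp (-y * sdTau v) * sdTau v)
          ≤ 1 * ((Real.exp (-(x/4) * sdTau v) * Real.exp (-(x/4) * sdTau v)) * sdTau v) := by
            gcongr; exact hw1 v
        _ = (Real.exp (-(x/4) * sdTau v) * sdTau v) * Real.exp (-(x/4) * sdTau v) := by ring
        _ ≤ (4 / x) * (Real.exp (x/4) * Real.exp (-(x/4) * v)) := by gcongr
        _ = _ := by ring)
    (sd_bound_integrable (x/4) _ (by linarith))
    (by
      refine Eventually.of_forall fun v y _ => ?_
      have : HasDerivAt (fun y : ℝ => -y * sdTau v) (-sdTau v) y := by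
        simpa using (hasDerivAt_id y).neg.mul_const (sdTau v)
      exact this.exp.const_mul (w v))
  refine ⟨_, ?_, key.2⟩
  have := sd_pos (fun v => -(w v * (Real.exp (-x * sdTau v) * (-sdTau v)))) key.1.neg (by
    intro v hv
    have := sdTau_pos hv
    have := hw0 v
    have : 0 < w v * (Real.exp (-x * sdTau v) * (sdTau v)) := by positivity
    linarith)
  rw [integral_neg] at this
  linarith

/-- The steepest-descent contour. -/
noncomputable def sdGam (v : ℝ) : ℂ :=
  ((π / 2 - Real.arctan (Real.sinh v) : ℝ) : ℂ) + (v : ℂ) * Complex.I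

lemma sqrt_sinh (v : ℝ) : Real.sqrt (1 + Real.sinh v ^ 2) = Real.cosh v := by
  rw [← Real.cosh_sq', Real.sqrt_sq (Real.cosh_pos v).le]

lemma sin_rect (a v : ℝ) : Complex.sin ((a : ℂ) + (v : ℂ) * Complex.I) =
    ((Real.sin a * Real.cosh v : ℝ) : ℂ) + ((Real.cos a * Real.sinh v : ℝ) : ℂ) * Complex.I := by
  rw [Complex.sin_add_mul_I]; push_cast; ring

lemma sdTau_eq (v : ℝ) : sdTau v = Real.sinh v / Real.cosh v * Real.sinh v := by
  unfold sdTau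
  have := Real.cosh_pos v
  have h := Real.cosh_sq v
  field_simp
  linarith

lemma cos_gam (v : ℝ) : Real.cos (π / 2 - Real.arctan (Real.sinh v)) * Real.sinh v = sdTau v := by
  rw [Real.cos_pi_div_two_sub, Real.sin_arctan, sqrt_sinh, sdTau_eq]

lemma sin_gam (v : ℝ) : Complex.sin (sdGam v) = 1 + (sdTau v : ℂ) * Complex.I := by
  unfold sdGam
  rw [sin_rect, cos_gam, Real.sin_pi_div_two_sub, Real.cos_arctan, sqrt_sinh]
  have := (Real.cosh_pos v).ne'
  rw [one_div_mul_cancel this]; simp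

lemma sdGam_deriv (v : ℝ) :
    HasDerivAt sdGam (Complex.I - ((1 / Real.cosh v : ℝ) : ℂ)) v := by
  have h1 : HasDerivAt (fun v : ℝ => π / 2 - Real.arctan (Real.sinh v)) (-(1 / Real.cosh v)) v := by
    have := ((Real.hasDerivAt_sinh v).arctan).const_sub (π / 2)
    refine this.congr_deriv ?_
    rw [← Real.cosh_sq']
    have := (Real.cosh_pos v).ne'
    field_simp
  have h2 : HasDerivAt (fun v : ℝ => (v : ℂ) * Complex.I) (1 * Complex.I) v :=
    (Complex.ofRealCLM.hasDerivAt (x := v)).mul_const Complex.I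
  have := h1.ofReal_comp.add h2
  refine this.congr_deriv ?_
  push_cast; ring

/-- The integrand `exp (i x sin z)`. -/
noncomputable def sdF (x : ℝ) (z : ℂ) : ℂ := Complex.exp (Complex.I * x * Complex.sin z)

lemma sdF_gam (x v : ℝ) :
    sdF x (sdGam v) = Complex.exp (Complex.I * x) * (Real.exp (-x * sdTau v) : ℝ) := by
  unfold sdF
  rw [sin_gam, Complex.ofReal_exp, ← Complex.exp_add]
  congr 1
  push_cast
  linear_combination (x * sdTau v : ℂ) * Complex.I_sq

lemma sdF_im (x v : ℝ) : sdF x ((v : ℂ) * Complex.I) = (Real.exp (-x * Real.sinh v) : ℝ) := by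
  unfold sdF
  rw [Complex.sin_mul_I, Complex.ofReal_exp]
  congr 1
  push_cast
  linear_combination (x * Complex.sinh v : ℂ) * Complex.I_sq

lemma sdF_norm (x a v : ℝ) :
    ‖sdF x ((a : ℂ) + (v : ℂ) * Complex.I)‖ = Real.exp (-x * (Real.cos a * Real.sinh v)) := by
  unfold sdF
  rw [sin_rect, Complex.norm_exp]
  congr 1
  simp [Complex.mul_re, Complex.mul_im, -Complex.ofReal_mul, -Complex.ofReal_sin,
    -Complex.ofReal_cosh, -Complex.ofReal_cos, -Complex.ofReal_sinh]

lemma sdF_cont (x : ℝ) : Continuous (sdF x) := by unfold sdF; fun_prop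

lemma sd_contour (x : ℝ) (hx : 0 < x) :
    (∫ a in (0:ℝ)..(π/2), sdF x a) - Complex.I * (∫ v in Set.Ioi (0:ℝ), Real.exp (-x * Real.sinh v) : ℝ)
    = Complex.exp (Complex.I * x) *
      ((∫ v in Set.Ioi (0:ℝ), (1 / Real.cosh v) * Real.exp (-x * sdTau v) : ℝ) -
        Complex.I * (∫ v in Set.Ioi (0:ℝ), 1 * Real.exp (-x * sdTau v) : ℝ)) := by
  have hd : Differentiable ℂ (sdF x) := by unfold sdF; fun_prop
  obtain ⟨E, hE⟩ := hd.isExactOn_univ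
  replace hE : ∀ z, HasDerivAt E (sdF x z) z := fun z => hE z (Set.mem_univ z)
  have hFc := sdF_cont x
  have hcosh : Continuous fun v : ℝ => 1 / Real.cosh v :=
    continuous_const.div Real.continuous_cosh (fun v => (Real.cosh_pos v).ne')
  have htau := sdTau_cont
  have hgam : Continuous sdGam := by
    unfold sdGam
    have := Real.continuous_arctan
    fun_prop
  -- horizontal pieces
  have H (b v : ℝ) : (∫ a in (0:ℝ)..b, sdF x ((a : ℂ) + (v : ℂ) * Complex.I)) =
      E ((b : ℂ) + (v : ℂ) * Complex.I) - E ((v : ℂ) * Complex.I) := by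
    rw [intervalIntegral.integral_eq_sub_of_hasDerivAt
      (f := fun a : ℝ => E ((a : ℂ) + (v : ℂ) * Complex.I))]
    · simp
    · intro a _
      have h1 : HasDerivAt (fun a : ℝ => (a : ℂ) + (v : ℂ) * Complex.I) 1 a :=
        (Complex.ofRealCLM.hasDerivAt (x := a)).add_const _
      have := (hE _).comp a h1
      rw [mul_one] at this
      exact this
    · apply Continuous.intervalIntegrable; fun_prop
  have H0 : (∫ a in (0:ℝ)..(π/2), sdF x a) = E ((π / 2 : ℝ) : ℂ) - E 0 := by
    simpa using H (π/2) 0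
  have H1 (V : ℝ) : (∫ v in (0:ℝ)..V, ((Real.exp (-x * Real.sinh v) : ℝ) : ℂ) * Complex.I) =
      E ((V : ℂ) * Complex.I) - E 0 := by
    rw [intervalIntegral.integral_eq_sub_of_hasDerivAt
      (f := fun v : ℝ => E ((v : ℂ) * Complex.I))]
    · simp
    · intro v _
      have h1 : HasDerivAt (fun v : ℝ => (v : ℂ) * Complex.I) (1 * Complex.I) v :=
        (Complex.ofRealCLM.hasDerivAt (x := v)).mul_const Complex.I
      have := (hE _).comp v h1
      rw [sdF_im, one_mul] at this
      exact this
    · apply Continuous.intervalIntegrable; fun_prop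
  have H2 (V : ℝ) : (∫ v in (0:ℝ)..V, Complex.exp (Complex.I * x) *
        ((Real.exp (-x * sdTau v) : ℝ) : ℂ) * (Complex.I - ((1 / Real.cosh v : ℝ) : ℂ))) =
      E (sdGam V) - E ((π / 2 : ℝ) : ℂ) := by
    rw [intervalIntegral.integral_eq_sub_of_hasDerivAt
      (f := fun v : ℝ => E (sdGam v))]
    · simp [sdGam]
    · intro v _
      have := (hE _).comp v (sdGam_deriv v)
      rw [sdF_gam] at this
      exact this
    · apply Continuous.intervalIntegrable
      have := Complex.continuous_ofReal.comp hcosh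
      simp only [Function.comp_def] at this
      fun_prop
  have H3 (V : ℝ) (hV : 0 < V) : ‖E (sdGam V) - E ((V : ℂ) * Complex.I)‖ ≤
      Real.exp (-x * sdTau V) * (π / 2) := by
    unfold sdGam
    rw [← H]
    have hs : 0 < Real.arctan (Real.sinh V) := Real.arctan_pos.2 (Real.sinh_pos_iff.2 hV)
    have hs2 := Real.arctan_lt_pi_div_two (Real.sinh V)
    have hsinh := Real.sinh_pos_iff.2 hV
    refine (intervalIntegral.norm_integral_le_of_norm_le_const
      (C := Real.exp (-x * sdTau V)) ?_).trans ?_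
    · intro a ha
      rw [Set.uIoc_of_le (by linarith)] at ha
      rw [sdF_norm, ← cos_gam]
      have : Real.cos (π / 2 - Real.arctan (Real.sinh V)) ≤ Real.cos a :=
        Real.cos_le_cos_of_nonneg_of_le_pi ha.1.le (by linarith [Real.pi_pos]) ha.2
      apply Real.exp_le_exp.2
      have := mul_le_mul_of_nonneg_right this hsinh.le
      nlinarith
    · gcongr
      rw [abs_of_nonneg] <;> linarith
  have htop : Tendsto sdTau atTop atTop := by
    apply tendsto_atTop_mono' atTop (f₁ := fun v : ℝ => v - 1)
    · filter_upwards [eventually_ge_atTop 0] with v hv using sdTau_ge v hv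
    · exact tendsto_atTop_add_const_right _ _ tendsto_id
  have H4 : Tendsto (fun V : ℝ => E (sdGam V) - E ((V : ℂ) * Complex.I)) atTop (nhds 0) := by
    apply squeeze_zero_norm' (a := fun V => Real.exp (-x * sdTau V) * (π / 2))
    · filter_upwards [eventually_gt_atTop 0] with V hV using H3 V hV
    · have : Tendsto (fun V => -x * sdTau V) atTop atBot :=
        htop.const_mul_atTop_of_neg (by linarith)
      simpa using (Real.tendsto_exp_atBot.comp this).mul_const (π / 2)
  have I1 : IntegrableOn (fun v : ℝ => Real.exp (-x * Real.sinh v)) (Set.Ioi 0) := by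
    refine Integrable.mono' (exp_neg_integrableOn_Ioi 0 hx)
      (Continuous.aestronglyMeasurable (by fun_prop)) ?_
    filter_upwards [self_mem_ae_restrict measurableSet_Ioi] with v hv
    have hv' : 0 < v := hv
    rw [Real.norm_of_nonneg (Real.exp_pos _).le]
    apply Real.exp_le_exp.2
    have := Real.self_le_sinh_iff.2 hv'.le
    nlinarith
  have I2 := sd_integrable (fun _ => 1) continuous_const (by simp) (by simp) x hx
  have I3 := sd_integrable (fun v => 1 / Real.cosh v) hcosh
    (fun v => by have := Real.cosh_pos v; positivity)
    (fun v => by rw [div_le_one (Real.cosh_pos v)]; exact Real.one_le_cosh v) x hx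
  have J1 : IntegrableOn (fun v : ℝ => ((Real.exp (-x * Real.sinh v) : ℝ) : ℂ) * Complex.I)
      (Set.Ioi 0) := (I1.ofReal (𝕜 := ℂ)).mul_const _
  have J2e : (fun v : ℝ => Complex.exp (Complex.I * x) *
        ((Real.exp (-x * sdTau v) : ℝ) : ℂ) * (Complex.I - ((1 / Real.cosh v : ℝ) : ℂ))) =
      fun v : ℝ => Complex.exp (Complex.I * x) *
        (Complex.I * ((1 * Real.exp (-x * sdTau v) : ℝ) : ℂ) -
        (((1 / Real.cosh v) * Real.exp (-x * sdTau v) : ℝ) : ℂ)) := by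
    funext v; push_cast; ring
  have J2a : IntegrableOn (fun v : ℝ =>
      Complex.I * ((1 * Real.exp (-x * sdTau v) : ℝ) : ℂ)) (Set.Ioi 0) :=
    (I2.ofReal (𝕜 := ℂ)).const_mul _
  have J2b : IntegrableOn (fun v : ℝ =>
        (((1 / Real.cosh v) * Real.exp (-x * sdTau v) : ℝ) : ℂ)) (Set.Ioi 0) :=
    I3.ofReal (𝕜 := ℂ)
  have J2 : IntegrableOn (fun v : ℝ => Complex.exp (Complex.I * x) *
        (Complex.I * ((1 * Real.exp (-x * sdTau v) : ℝ) : ℂ) -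
        (((1 / Real.cosh v) * Real.exp (-x * sdTau v) : ℝ) : ℂ))) (Set.Ioi 0) :=
    (J2a.sub J2b).const_mul _
  have T1 := intervalIntegral_tendsto_integral_Ioi 0 J1 tendsto_id
  have T2 := intervalIntegral_tendsto_integral_Ioi 0 J2 tendsto_id
  rw [← J2e] at T2
  simp only [id, H1] at T1
  simp only [id, H2] at T2
  have T3 := tendsto_nhds_unique ((T2.sub T1).sub H4) (tendsto_const_nhds.congr (fun V => by
    show E 0 - E ((π / 2 : ℝ) : ℂ) = _
    ring))
  rw [J2e, integral_const_mul, integral_sub J2a J2b, integral_const_mul, integral_mul_const,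
    integral_complex_ofReal,
    integral_complex_ofReal, integral_complex_ofReal] at T3
  rw [H0]
  linear_combination T3

lemma sdF_half (x : ℝ) :
    (∫ a in (0:ℝ)..π, sdF x a) = 2 * ∫ a in (0:ℝ)..(π/2), sdF x a := by
  have hFc := sdF_cont x
  have hi (a b : ℝ) : IntervalIntegrable (fun a : ℝ => sdF x a) volume a b := by
    apply Continuous.intervalIntegrable; fun_prop
  rw [← intervalIntegral.integral_add_adjacent_intervals (hi 0 (π/2)) (hi (π/2) π)]
  have h := intervalIntegral.integral_comp_sub_left (a := 0) (b := π/2)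
    (fun a : ℝ => sdF x a) π
  have h2 : (fun a : ℝ => sdF x ((π - a : ℝ) : ℂ)) = fun a : ℝ => sdF x a := by
    funext a
    unfold sdF
    push_cast
    rw [Complex.sin_pi_sub]
  rw [h2] at h
  rw [show π - π / 2 = π / 2 by ring, sub_zero] at h
  rw [← h]; ring

lemma sdF_real (x a : ℝ) : sdF x a = ((Real.cos (x * Real.sin a) : ℝ) : ℂ) +
    Complex.I * ((Real.sin (x * Real.sin a) : ℝ) : ℂ) := by
  unfold sdF
  rw [show Complex.I * x * Complex.sin a = ((x * Real.sin a : ℝ) : ℂ) * Complex.I by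
    push_cast; ring, Complex.exp_mul_I]
  push_cast; ring

lemma besselJ_zero_eq (x : ℝ) :
    besselJ 0 x = (1 / π) * ∫ θ in (0:ℝ)..π, Real.cos (x * Real.sin θ) := by
  simp [besselJ]

lemma besselY_zero_eq (x : ℝ) :
    besselY 0 x = (1 / π) * (∫ θ in (0:ℝ)..π, Real.sin (x * Real.sin θ)) -
      (2 / π) * ∫ t in Set.Ioi (0:ℝ), Real.exp (-x * Real.sinh t) := by
  unfold besselY
  have e : (∫ t in Set.Ioi (0:ℝ),
        (Real.exp ((0:ℕ) * t) + (-1 : ℝ) ^ 0 * Real.exp (-((0:ℕ) : ℝ) * t)) *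
          Real.exp (-x * Real.sinh t)) = 2 * ∫ t in Set.Ioi (0:ℝ), Real.exp (-x * Real.sinh t) := by
    rw [← integral_const_mul]
    congr 1
    funext t
    norm_num
  rw [e, intervalIntegral.integral_sub]
  · simp only [intervalIntegral.integral_const, smul_eq_mul]
    have := Real.pi_pos.ne'
    simp only [Nat.cast_zero, zero_mul, sub_zero]
    field_simp
  · apply Continuous.intervalIntegrable; fun_prop
  · simp

lemma hankel_eq (x : ℝ) :
    (besselJ 0 x : ℂ) + Complex.I * (besselY 0 x : ℂ) = (2 / π : ℝ) *
    ((∫ a in (0:ℝ)..(π/2), sdF x a) -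
      Complex.I * (∫ v in Set.Ioi (0:ℝ), Real.exp (-x * Real.sinh v) : ℝ)) := by
  have h := sdF_half x
  have h2 : (∫ a in (0:ℝ)..π, sdF x a) =
      ((∫ θ in (0:ℝ)..π, Real.cos (x * Real.sin θ) : ℝ) : ℂ) +
      Complex.I * ((∫ θ in (0:ℝ)..π, Real.sin (x * Real.sin θ) : ℝ) : ℂ) := by
    simp only [sdF_real]
    rw [intervalIntegral.integral_add, intervalIntegral.integral_const_mul,
      intervalIntegral.integral_ofReal, intervalIntegral.integral_ofReal]
    · apply Continuous.intervalIntegrable; fun_prop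
    · apply Continuous.intervalIntegrable; fun_prop
  have h3 : (∫ a in (0:ℝ)..(π/2), sdF x a) =
      (1/2) * (((∫ θ in (0:ℝ)..π, Real.cos (x * Real.sin θ) : ℝ) : ℂ) +
      Complex.I * ((∫ θ in (0:ℝ)..π, Real.sin (x * Real.sin θ) : ℝ) : ℂ)) := by
    rw [← h2, h]; ring
  rw [h3, besselJ_zero_eq, besselY_zero_eq]
  push_cast
  ring

lemma modulus_eq (x : ℝ) (hx : 0 < x) :
    besselJ 0 x ^ 2 + besselY 0 x ^ 2 = (2 / π) ^ 2 *
      ((∫ v in Set.Ioi (0:ℝ), (1 / Real.cosh v) * Real.exp (-x * sdTau v)) ^ 2 +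
        (∫ v in Set.Ioi (0:ℝ), 1 * Real.exp (-x * sdTau v)) ^ 2) := by
  have h := hankel_eq x
  rw [sd_contour x hx] at h
  have h2 := congrArg Complex.normSq h
  generalize (∫ v in Set.Ioi (0:ℝ), (1 / Real.cosh v) * Real.exp (-x * sdTau v)) = P at *
  generalize (∫ v in Set.Ioi (0:ℝ), 1 * Real.exp (-x * sdTau v)) = Q at *
  have n (a b : ℝ) : Complex.normSq ((a : ℂ) + Complex.I * (b : ℂ)) = a ^ 2 + b ^ 2 := by
    rw [mul_comm, Complex.normSq_add_mul_I]
  have e : Complex.normSq (Complex.exp (Complex.I * x)) = 1 := by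
    rw [Complex.normSq_eq_norm_sq, mul_comm, Complex.norm_exp_ofReal_mul_I]; norm_num
  have m : (P : ℂ) - Complex.I * (Q : ℂ) = (P : ℂ) + Complex.I * ((-Q : ℝ) : ℂ) := by
    push_cast; ring
  rw [map_mul, map_mul, e, m, n, n, Complex.normSq_ofReal] at h2
  rw [h2]; ring

lemma modulus_deriv (x : ℝ) (hx : 0 < x) :
    0 < besselJ 0 x ^ 2 + besselY 0 x ^ 2 ∧
    ∃ D < 0, HasDerivAt (fun x => besselJ 0 x ^ 2 + besselY 0 x ^ 2) D x := by
  have hcosh : Continuous fun v : ℝ => 1 / Real.cosh v :=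
    continuous_const.div Real.continuous_cosh (fun v => (Real.cosh_pos v).ne')
  have c0 : ∀ v : ℝ, 0 < 1 / Real.cosh v := fun v => by have := Real.cosh_pos v; positivity
  have c1 : ∀ v : ℝ, 1 / Real.cosh v ≤ 1 :=
    fun v => by rw [div_le_one (Real.cosh_pos v)]; exact Real.one_le_cosh v
  obtain ⟨D1, hD1, hP⟩ := sd_deriv (fun v => 1 / Real.cosh v) hcosh c0 c1 x hx
  obtain ⟨D2, hD2, hQ⟩ := sd_deriv (fun _ => 1) continuous_const (by simp) (by simp) x hx
  have pP := sd_pos _ (sd_integrable (fun v => 1 / Real.cosh v) hcosh c0 c1 x hx)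
    (fun v _ => mul_pos (c0 v) (Real.exp_pos _))
  have pQ := sd_pos _ (sd_integrable (fun _ => 1) continuous_const (by simp) (by simp) x hx)
    (fun v _ => mul_pos one_pos (Real.exp_pos _))
  have hpi := Real.pi_pos
  constructor
  · rw [modulus_eq x hx]; positivity
  · have hd := ((hP.pow 2).add (hQ.pow 2)).const_mul ((2 / π) ^ 2)
    refine ⟨_, ?_, hd.congr_of_eventuallyEq ?_⟩
    · apply mul_neg_of_pos_of_neg (by positivity)
      simp only [Nat.cast_ofNat, Nat.add_one_sub_one, pow_one]
      apply add_neg <;> apply mul_neg_of_pos_of_neg <;> first | assumption | positivity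
    · filter_upwards [Ioi_mem_nhds hx] with y hy
      simpa using modulus_eq y hy

lemma besselJ_zero_zero : besselJ 0 0 = 1 := by
  rw [besselJ_zero_eq]
  have := Real.pi_pos.ne'
  simp [this]

lemma besselJ_deriv_zero : HasDerivAt (besselJ 0) 0 0 := by
  have key := (intervalIntegral.hasDerivAt_integral_of_dominated_loc_of_deriv_le
    (μ := volume) (a := 0) (b := π) (s := Set.univ) (x₀ := (0:ℝ))
    (F := fun x θ => Real.cos (x * Real.sin θ))
    (F' := fun x θ => -Real.sin (x * Real.sin θ) * Real.sin θ)
    (bound := fun _ => 1) univ_mem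
    (Eventually.of_forall fun y => Continuous.aestronglyMeasurable (by fun_prop))
    (Continuous.intervalIntegrable (by fun_prop) _ _)
    (Continuous.aestronglyMeasurable (by fun_prop))
    (Eventually.of_forall fun θ _ y _ => by
      rw [norm_mul, norm_neg]
      exact mul_le_one₀ (Real.abs_sin_le_one _) (norm_nonneg _) (Real.abs_sin_le_one _))
    (by simp)
    (Eventually.of_forall fun θ _ y _ => by
      have : HasDerivAt (fun y : ℝ => y * Real.sin θ) (Real.sin θ) y := by
        simpa using (hasDerivAt_id y).mul_const (Real.sin θ)
      exact this.cos)).2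
  have k2 := key.const_mul (1 / π)
  have e : besselJ 0 = fun x => (1 / π) * ∫ θ in (0:ℝ)..π, Real.cos (x * Real.sin θ) :=
    funext besselJ_zero_eq
  rw [e]
  refine k2.congr_deriv ?_
  simp

/-- With `g(y) = (λ/k)·|J₀(ky)| / √(J₀(ky+kξ)² + Y₀(ky+kξ)²)`
for constants `λ, k, ξ > 0`, the (one-sided) derivative of `g` at `0` is positive. -/
theorem deriv_g_at_zero_pos (l k ξ : ℝ) (hl : 0 < l) (hk : 0 < k) (hξ : 0 < ξ) :
    0 < derivWithin
        (fun y : ℝ =>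
          (l / k) * |besselJ 0 (k * y)| /
            Real.sqrt (besselJ 0 (k * y + k * ξ) ^ 2 + besselY 0 (k * y + k * ξ) ^ 2))
        (Set.Ici 0) 0 := by
  have hx : 0 < k * ξ := mul_pos hk hξ
  obtain ⟨hF, D, hD, hFD⟩ := modulus_deriv (k * ξ) hx
  have hlin : HasDerivAt (fun y : ℝ => k * y) k 0 := by
    simpa using (hasDerivAt_id (0:ℝ)).const_mul k
  have hlin2 : HasDerivAt (fun y : ℝ => k * y + k * ξ) k 0 := hlin.add_const _
  have hJ : HasDerivAt (fun y : ℝ => besselJ 0 (k * y)) (0 * k) 0 := by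
    have h0 : HasDerivAt (besselJ 0) 0 (k * 0) := by
      rw [mul_zero]; exact besselJ_deriv_zero
    exact h0.comp (0:ℝ) hlin
  have hpos : ∀ᶠ y in nhds (0:ℝ), 0 < besselJ 0 (k * y) := by
    apply hJ.continuousAt.eventually_const_lt
    simp [besselJ_zero_zero]
  have hJabs : HasDerivAt (fun y : ℝ => |besselJ 0 (k * y)|) (0 * k) 0 := by
    apply hJ.congr_of_eventuallyEq
    filter_upwards [hpos] with y hy using abs_of_pos hy
  have hM : HasDerivAt (fun y : ℝ =>
      besselJ 0 (k * y + k * ξ) ^ 2 + besselY 0 (k * y + k * ξ) ^ 2) (D * k) 0 := by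
    have h0 : HasDerivAt (fun x => besselJ 0 x ^ 2 + besselY 0 x ^ 2) D (k * 0 + k * ξ) := by
      rw [mul_zero, zero_add]; exact hFD
    exact h0.comp (0:ℝ) hlin2
  have hF0 : 0 < besselJ 0 (k * 0 + k * ξ) ^ 2 + besselY 0 (k * 0 + k * ξ) ^ 2 := by
    rw [mul_zero, zero_add]; exact hF
  have hS := hM.sqrt hF0.ne'
  have hsq := Real.sqrt_pos.2 hF0
  have hg := (hJabs.const_mul (l / k)).div hS hsq.ne'
  have hg' := hg.hasDerivWithinAt (s := Set.Ici (0:ℝ))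
  have hres := hg'.derivWithin (uniqueDiffOn_Ici (0:ℝ) 0 Set.self_mem_Ici)
  refine lt_of_lt_of_eq ?_ hres.symm
  apply div_pos _ (by positivity)
  rw [zero_mul, mul_zero, zero_mul, zero_sub, mul_zero k, besselJ_zero_zero, abs_one, mul_one,
    neg_pos]
  rw [mul_zero] at hsq
  apply mul_neg_of_pos_of_neg (by positivity)
  exact div_neg_of_neg_of_pos (mul_neg_of_neg_of_pos hD hk) (by positivity)
end
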